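/- arXiv:1505.06444 — 5 statements merged into one kernel-verified Lean document; each statement's English description precedes it below -/
import Mathlib

section
/- Let K be a convex body (a compact convex set with nonempty interior) in ℝ^d whose centroid c(K) = (1/vol(K)) ∫_K x dx equals the origin. Then the number of integer lattice points of K satisfies #(K ∩ ℤ^d) < 2^d · (2/λ₁(K) + 1)^d, where λ₁(K) = min{λ > 0 : λK ∩ ℤ^d ≠ {0}} is the first successive minimum of K. -/
open MeasureTheory Set Pointwise

/-- The set of integer lattice points of `ℝ^d`. -/
def latticePts (d : ℕ) : Set (Fin d → ℝ) := {x | ∀ i, ∃ z : ℤ, x i = (z : ℝ)}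


lemma bm1_compact (A B E : Set ℝ) (hA : IsCompact A) (hB : IsCompact B) (hAn : A.Nonempty)
    (hBn : B.Nonempty) (a b : ℝ) (ha : 0 < a) (hb : 0 < b)
    (h : ∀ x ∈ A, ∀ y ∈ B, a * x + b * y ∈ E) :
    ENNReal.ofReal a * volume A + ENNReal.ofReal b * volume B ≤ volume E := by
  obtain ⟨xM, hxM, hxM'⟩ := hA.exists_isGreatest hAn
  obtain ⟨ym, hym, hym'⟩ := hB.exists_isLeast hBn
  have h1 : volume ((b * ym) +ᵥ (a • A)) = ENNReal.ofReal a * volume A := by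
    rw [measure_vadd, Measure.addHaar_smul]; simp [abs_of_pos ha]
  have h2 : volume ((a * xM) +ᵥ (b • B)) = ENNReal.ofReal b * volume B := by
    rw [measure_vadd, Measure.addHaar_smul]; simp [abs_of_pos hb]
  rw [← h1, ← h2, ← measure_union₀]
  · apply measure_mono
    rintro z (hz | hz)
    · obtain ⟨_, ⟨x, hx, rfl⟩, rfl⟩ := hz
      have := h x hx ym hym
      simpa [add_comm] using this
    · obtain ⟨_, ⟨y, hy, rfl⟩, rfl⟩ := hz
      have := h xM hxM y hy
      simpa [add_comm] using this
  · exact ((hB.smul b).vadd _).isClosed.measurableSet.nullMeasurableSet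
  · refine measure_mono_null (t := {a * xM + b * ym}) ?_ (by simp)
    rintro z ⟨hz, hz'⟩
    obtain ⟨_, ⟨x, hx, rfl⟩, rfl⟩ := hz
    obtain ⟨_, ⟨y, hy, rfl⟩, hy2⟩ := hz'
    simp only [smul_eq_mul, vadd_eq_add, mem_singleton_iff] at hy2 ⊢
    have := mul_le_mul_of_nonneg_left (hxM' hx) ha.le
    have := mul_le_mul_of_nonneg_left (hym' hy) hb.le
    linarith

lemma bm1 (A B E : Set ℝ) (hA : MeasurableSet A) (hB : MeasurableSet B) (hAn : A.Nonempty)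
    (hBn : B.Nonempty) (hAf : volume A ≠ ⊤) (hBf : volume B ≠ ⊤)
    (a b : ℝ) (ha : 0 < a) (hb : 0 < b) (hab : a + b = 1)
    (h : ∀ x ∈ A, ∀ y ∈ B, a * x + b * y ∈ E) :
    ENNReal.ofReal a * volume A + ENNReal.ofReal b * volume B ≤ volume E := by
  apply ENNReal.le_of_forall_pos_le_add
  intro ε hε _
  have hε' : (ε : ENNReal) ≠ 0 := by simpa using hε.ne'
  obtain ⟨A', hA', hA'c, hA'v⟩ := hA.exists_isCompact_lt_add hAf hε'
  obtain ⟨B', hB', hB'c, hB'v⟩ := hB.exists_isCompact_lt_add hBf hε'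
  obtain ⟨x, hx⟩ := hAn
  obtain ⟨y, hy⟩ := hBn
  have key := bm1_compact (insert x A') (insert y B') E (hA'c.insert x) (hB'c.insert y)
    ⟨x, by simp⟩ ⟨y, by simp⟩ a b ha hb
    (fun u hu v hv => h u (insert_subset hx hA' hu) v (insert_subset hy hB' hv))
  have e1 : volume A ≤ volume (insert x A') + ε :=
    hA'v.le.trans (by gcongr; exact subset_insert _ _)
  have e2 : volume B ≤ volume (insert y B') + ε :=
    hB'v.le.trans (by gcongr; exact subset_insert _ _)
  calc _ ≤ ENNReal.ofReal a * (volume (insert x A') + ε) +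
        ENNReal.ofReal b * (volume (insert y B') + ε) := by gcongr
    _ = (ENNReal.ofReal a * volume (insert x A') + ENNReal.ofReal b * volume (insert y B')) +
        (ENNReal.ofReal a + ENNReal.ofReal b) * ε := by ring
    _ = (ENNReal.ofReal a * volume (insert x A') + ENNReal.ofReal b * volume (insert y B')) + ε := by
        rw [← ENNReal.ofReal_add ha.le hb.le, hab]; simp
    _ ≤ _ := by gcongr

lemma pl1 (f g h : ℝ → ℝ) (hf : Measurable f) (hg : Measurable g) (hh : Measurable h)
    (hf0 : ∀ x, 0 ≤ f x) (hg0 : ∀ x, 0 ≤ g x) (hh0 : ∀ x, 0 ≤ h x)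
    (hf1 : ∀ x, f x ≤ 1) (hg1 : ∀ x, g x ≤ 1)
    (hfs : ∀ t < 1, ∃ x, t < f x) (hgs : ∀ t < 1, ∃ x, t < g x)
    (R : ℝ) (hfR : ∀ x, f x ≠ 0 → x ∈ Icc (-R) R) (hgR : ∀ x, g x ≠ 0 → x ∈ Icc (-R) R)
    (a b : ℝ) (ha : 0 < a) (hb : 0 < b) (hab : a + b = 1)
    (H : ∀ x y, f x ^ a * g y ^ b ≤ h (a * x + b * y)) :
    ENNReal.ofReal a * (∫⁻ x, ENNReal.ofReal (f x)) + ENNReal.ofReal b * (∫⁻ x, ENNReal.ofReal (g x))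
      ≤ ∫⁻ x, ENNReal.ofReal (h x) := by
  rw [lintegral_eq_lintegral_meas_lt _ (.of_forall hf0) hf.aemeasurable,
    lintegral_eq_lintegral_meas_lt _ (.of_forall hg0) hg.aemeasurable,
    lintegral_eq_lintegral_meas_lt _ (.of_forall hh0) hh.aemeasurable]
  have mf : Measurable fun t => volume {x | t < f x} :=
    (show Antitone fun t => volume {x | t < f x} from
      fun s t hst => measure_mono fun x hx => lt_of_le_of_lt hst hx).measurable
  have mg : Measurable fun t => volume {x | t < g x} :=
    (show Antitone fun t => volume {x | t < g x} from
      fun s t hst => measure_mono fun x hx => lt_of_le_of_lt hst hx).measurable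
  rw [← lintegral_const_mul _ mf, ← lintegral_const_mul _ mg, ← lintegral_add_left (by fun_prop)]
  apply setLIntegral_mono' measurableSet_Ioi
  intro t ht
  have ht : 0 < t := ht
  by_cases ht1 : t < 1
  · apply bm1 _ _ _ (measurableSet_lt measurable_const hf) (measurableSet_lt measurable_const hg)
      (hfs t ht1) (hgs t ht1) _ _ a b ha hb hab
    · intro x hx y hy
      refine lt_of_lt_of_le ?_ (H x y)
      have e : t = t ^ a * t ^ b := by rw [← Real.rpow_add ht, hab, Real.rpow_one]
      conv_lhs => rw [e]
      exact mul_lt_mul'' (Real.rpow_lt_rpow ht.le hx ha) (Real.rpow_lt_rpow ht.le hy hb)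
        (by positivity) (by positivity)
    · refine ne_top_of_le_ne_top ?_ (measure_mono (t := Icc (-R) R) fun x hx => hfR x ?_)
      · simp
      · exact (ht.trans hx).ne'
    · refine ne_top_of_le_ne_top ?_ (measure_mono (t := Icc (-R) R) fun x hx => hgR x ?_)
      · simp
      · exact (ht.trans hx).ne'
  · have e1 : {x | t < f x} = ∅ := by
      ext x; simpa using (hf1 x).trans (not_lt.1 ht1)
    have e2 : {x | t < g x} = ∅ := by
      ext x; simpa using (hg1 x).trans (not_lt.1 ht1)
    simp [e1, e2]

abbrev boxR (n : ℕ) (R : ℝ) : Set (Fin n → ℝ) := Icc (fun _ => -R) (fun _ => R)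

def slc {n : ℕ} (A : Set (Fin (n+1) → ℝ)) (s : ℝ) : Set (Fin n → ℝ) := {y | (Fin.cons s y : Fin (n+1) → ℝ) ∈ A}

lemma slc_vol {n : ℕ} (A : Set (Fin (n+1) → ℝ)) (hA : MeasurableSet A) :
    (∀ s, MeasurableSet (slc A s)) ∧ (Measurable fun s => volume (slc A s)) ∧
    ∫⁻ s, volume (slc A s) = volume A := by
  have e := (volume_preserving_piFinSuccAbove (fun _ : Fin (n+1) => ℝ) 0).symm
  have hm := e.measurable hA
  have hs : ∀ s, slc A s = Prod.mk s ⁻¹'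
      ((MeasurableEquiv.piFinSuccAbove (fun _ : Fin (n+1) => ℝ) 0).symm ⁻¹' A) := by
    intro s
    ext y
    simp [slc, MeasurableEquiv.piFinSuccAbove, Fin.insertNthEquiv]
  refine ⟨fun s => ?_, ?_, ?_⟩
  · rw [hs]; exact measurable_prodMk_left hm
  · simp_rw [hs]; exact measurable_measure_prodMk_left hm
  · simp_rw [hs]
    rw [← Measure.prod_apply hm]
    exact e.measure_preimage hA.nullMeasurableSet

lemma slc_box {n : ℕ} (A : Set (Fin (n+1) → ℝ)) (R : ℝ) (hA : A ⊆ boxR (n+1) R) (s : ℝ) :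
    slc A s ⊆ boxR n R ∧ ((slc A s).Nonempty → s ∈ Icc (-R) R) := by
  constructor
  · intro y hy
    have := hA hy
    exact ⟨fun i => by simpa using this.1 i.succ, fun i => by simpa using this.2 i.succ⟩
  · rintro ⟨y, hy⟩
    have := hA hy
    exact ⟨by simpa using this.1 0, by simpa using this.2 0⟩

lemma slc_lint {n : ℕ} (A : Set (Fin (n+1) → ℝ)) (hA : MeasurableSet A) (R : ℝ)
    (hAR : A ⊆ boxR (n+1) R) (M : ℝ) (_hM : 0 < M) :
    ∫⁻ s, ENNReal.ofReal (volume.real (slc A s) / M) = ENNReal.ofReal (volume.real A / M) := by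
  have hf : ∀ s, volume (slc A s) ≠ ⊤ := fun s =>
    ne_top_of_le_ne_top (isCompact_Icc.measure_ne_top) (measure_mono (slc_box A R hAR s).1)
  have hfA : volume A ≠ ⊤ :=
    ne_top_of_le_ne_top (isCompact_Icc.measure_ne_top) (measure_mono hAR)
  simp_rw [div_eq_mul_inv]
  have : ∀ x : ℝ, ENNReal.ofReal (volume.real (slc A x) * M⁻¹) = volume (slc A x) * ENNReal.ofReal M⁻¹ := by
    intro x
    rw [ENNReal.ofReal_mul (by positivity), measureReal_def, ENNReal.ofReal_toReal (hf x)]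
  simp_rw [this]
  rw [lintegral_mul_const _ (slc_vol A hA).2.1, (slc_vol A hA).2.2,
    ENNReal.ofReal_mul (by positivity), measureReal_def, ENNReal.ofReal_toReal hfA]

lemma slc_sup {n : ℕ} (A : Set (Fin (n+1) → ℝ)) (hA : MeasurableSet A) (R : ℝ)
    (hAR : A ⊆ boxR (n+1) R) (h0 : volume.real A ≠ 0) :
    ∃ M > 0, (∀ s, volume.real (slc A s) / M ≤ 1) ∧
      (∀ t < 1, ∃ s, t < volume.real (slc A s) / M) := by
  have hb : BddAbove (range fun s => volume.real (slc A s)) := by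
    refine ⟨volume.real (boxR n R), ?_⟩
    rintro _ ⟨s, rfl⟩
    exact measureReal_mono (slc_box A R hAR s).1 (isCompact_Icc.measure_ne_top)
  have hpos : 0 < ⨆ s, volume.real (slc A s) := by
    by_contra hc
    apply h0
    have h1 : ∀ s, volume.real (slc A s) = 0 := fun s =>
      le_antisymm ((le_ciSup hb s).trans (not_lt.1 hc)) (by positivity)
    have := slc_lint A hA R hAR 1 one_pos
    simp only [h1] at this
    simp at this
    have h2 : 0 ≤ volume.real A := by positivity
    rw [measureReal_def] at *
    grind
  refine ⟨_, hpos, fun s => ?_, fun t ht => ?_⟩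
  · rw [div_le_one hpos]; exact le_ciSup hb s
  · have : t * (⨆ s, volume.real (slc A s)) < ⨆ s, volume.real (slc A s) := by nlinarith
    obtain ⟨s, hs⟩ := exists_lt_of_lt_ciSup this
    exact ⟨s, by rwa [lt_div_iff₀ hpos]⟩

lemma bmn (n : ℕ) (R : ℝ) (a b : ℝ) (ha : 0 < a) (hb : 0 < b) (hab : a + b = 1) :
    ∀ A B E : Set (Fin n → ℝ), MeasurableSet A → MeasurableSet B → MeasurableSet E →
      A ⊆ boxR n R → B ⊆ boxR n R → E ⊆ boxR n R →
      (∀ x ∈ A, ∀ y ∈ B, a • x + b • y ∈ E) →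
      volume.real A ^ a * volume.real B ^ b ≤ volume.real E := by
  induction n with
  | zero =>
    intro A B E hA hB hE _ _ _ h
    rcases A.eq_empty_or_nonempty with rfl | ⟨x, hx⟩
    · simp [Real.zero_rpow ha.ne']
    rcases B.eq_empty_or_nonempty with rfl | ⟨y, hy⟩
    · simp [Real.zero_rpow hb.ne']
    have hz := h x hx y hy
    have e1 : A = univ := Subsingleton.eq_univ_of_nonempty ⟨x, hx⟩
    have e2 : B = univ := Subsingleton.eq_univ_of_nonempty ⟨y, hy⟩
    have e3 : E = univ := Subsingleton.eq_univ_of_nonempty ⟨_, hz⟩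
    subst e1 e2 e3
    simp [measureReal_def, volume_pi]
  | succ n ih =>
    intro A B E hA hB hE hAR hBR hER h
    by_cases hA0 : volume.real A = 0
    · simp [hA0, Real.zero_rpow ha.ne']
    by_cases hB0 : volume.real B = 0
    · simp [hB0, Real.zero_rpow hb.ne']
    obtain ⟨M, hM, hM1, hM2⟩ := slc_sup A hA R hAR hA0
    obtain ⟨N, hN, hN1, hN2⟩ := slc_sup B hB R hBR hB0
    have hP : 0 < M ^ a * N ^ b := by positivity
    have key := pl1 (fun s => volume.real (slc A s) / M) (fun s => volume.real (slc B s) / N)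
      (fun s => volume.real (slc E s) / (M ^ a * N ^ b))
      ((slc_vol A hA).2.1.ennreal_toReal.div_const _)
      ((slc_vol B hB).2.1.ennreal_toReal.div_const _)
      ((slc_vol E hE).2.1.ennreal_toReal.div_const _)
      (fun _ => by positivity) (fun _ => by positivity) (fun _ => by positivity)
      hM1 hN1 hM2 hN2 R
      (fun x hx => (slc_box A R hAR x).2 (by
        by_contra hc
        rw [not_nonempty_iff_eq_empty] at hc
        simp [hc] at hx))
      (fun x hx => (slc_box B R hBR x).2 (by
        by_contra hc
        rw [not_nonempty_iff_eq_empty] at hc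
        simp [hc] at hx)) a b ha hb hab
      (fun s t => by
        rw [Real.div_rpow (by positivity) hM.le, Real.div_rpow (by positivity) hN.le,
          div_mul_div_comm]
        gcongr
        refine ih _ _ _ ((slc_vol A hA).1 s) ((slc_vol B hB).1 t) ((slc_vol E hE).1 _)
          (slc_box A R hAR s).1 (slc_box B R hBR t).1 (slc_box E R hER _).1 ?_
        intro x hx y hy
        have := h _ hx _ hy
        have e : a • (Fin.cons s x : Fin (n+1) → ℝ) + b • (Fin.cons t y : Fin (n+1) → ℝ) =
          Fin.cons (a * s + b * t) (a • x + b • y) := by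
          ext i
          refine Fin.cases ?_ (fun i => ?_) i <;> simp
        rw [e] at this
        exact this)
    rw [slc_lint A hA R hAR M hM, slc_lint B hB R hBR N hN, slc_lint E hE R hER _ hP,
      ← ENNReal.ofReal_mul ha.le, ← ENNReal.ofReal_mul hb.le,
      ← ENNReal.ofReal_add (by positivity) (by positivity),
      ENNReal.ofReal_le_ofReal_iff (by positivity)] at key
    have am := (Real.geom_mean_le_arith_mean2_weighted ha.le hb.le
      (show 0 ≤ volume.real A / M by positivity) (show 0 ≤ volume.real B / N by positivity) hab).trans key
    rw [Real.div_rpow (by positivity) hM.le, Real.div_rpow (by positivity) hN.le,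
          div_mul_div_comm, div_le_div_iff_of_pos_right hP] at am
    exact am

/-- Brunn–Minkowski, dimensional form. -/
lemma bm_dim (n : ℕ) (hn : n ≠ 0) (a b : ℝ) (ha : 0 < a) (hb : 0 < b)
    (A B E : Set (Fin n → ℝ)) (hA : IsCompact A) (hB : IsCompact B) (hE : IsCompact E)
    (hAn : A.Nonempty) (hBn : B.Nonempty)
    (h : ∀ x ∈ A, ∀ y ∈ B, a • x + b • y ∈ E) :
    a * volume.real A ^ (1 / n : ℝ) + b * volume.real B ^ (1 / n : ℝ) ≤
      volume.real E ^ (1 / n : ℝ) := by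
  have hn' : (n : ℝ) ≠ 0 := by exact_mod_cast hn
  have hroot : ∀ x : ℝ, 0 ≤ x → (x ^ n) ^ (1 / n : ℝ) = x := fun x hx => by
    rw [one_div, Real.pow_rpow_inv_natCast hx hn]
  have hsm : ∀ (r : ℝ) (S : Set (Fin n → ℝ)), 0 ≤ r → volume.real (r • S) = r ^ n * volume.real S := by
    intro r S hr
    rw [measureReal_def, Measure.addHaar_smul, ENNReal.toReal_mul, measureReal_def]
    simp only [Module.finrank_fintype_fun_eq_card, Fintype.card_fin, abs_of_nonneg (pow_nonneg hr n)]
    rw [ENNReal.toReal_ofReal (pow_nonneg hr n)]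
  -- one-sided bounds
  have one : ∀ (r : ℝ), 0 < r → ∀ (S : Set (Fin n → ℝ)) (v : Fin n → ℝ), (∀ x ∈ S, r • x + v ∈ E) →
      r * volume.real S ^ (1 / n : ℝ) ≤ volume.real E ^ (1 / n : ℝ) := by
    intro r hr S v hS
    have h1 : volume.real (r • S) ≤ volume.real E := by
      have : volume.real (v +ᵥ (r • S)) ≤ volume.real E := by
        apply measureReal_mono _ hE.measure_ne_top
        rintro _ ⟨_, ⟨x, hx, rfl⟩, rfl⟩
        have := hS x hx
        simpa [add_comm] using this
      simpa [measureReal_def, measure_vadd] using this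
    rw [hsm r S hr.le] at h1
    calc _ = (r ^ n * volume.real S) ^ (1 / n : ℝ) := by
          rw [Real.mul_rpow (by positivity) (by positivity), hroot r hr.le]
      _ ≤ _ := Real.rpow_le_rpow (by positivity) h1 (by positivity)
  obtain ⟨x0, hx0⟩ := hAn
  obtain ⟨y0, hy0⟩ := hBn
  by_cases hA0 : volume.real A = 0
  · rw [hA0, Real.zero_rpow (by positivity), mul_zero, zero_add]
    exact one b hb B (a • x0) fun y hy => by rw [add_comm]; exact h _ hx0 _ hy
  by_cases hB0 : volume.real B = 0
  · rw [hB0, Real.zero_rpow (by positivity), mul_zero, add_zero]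
    exact one a ha A (b • y0) fun y hy => h _ hy _ hy0
  have hA0 : 0 < volume.real A := lt_of_le_of_ne (by positivity) (Ne.symm hA0)
  have hB0 : 0 < volume.real B := lt_of_le_of_ne (by positivity) (Ne.symm hB0)
  set α := volume.real A ^ (1 / n : ℝ) with hα
  set β := volume.real B ^ (1 / n : ℝ) with hβ
  have hαp : 0 < α := by positivity
  have hβp : 0 < β := by positivity
  have hαn : α ^ n = volume.real A := by
    rw [hα, one_div, Real.rpow_inv_natCast_pow hA0.le hn]
  have hβn : β ^ n = volume.real B := by
    rw [hβ, one_div, Real.rpow_inv_natCast_pow hB0.le hn]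
  set σ := a * α + b * β with hσ
  have hσp : 0 < σ := by positivity
  have cA : IsCompact (α⁻¹ • A) := hA.smul _
  have cB : IsCompact (β⁻¹ • B) := hB.smul _
  have cE : IsCompact (σ⁻¹ • E) := hE.smul _
  obtain ⟨R, hR⟩ : ∃ R : ℝ, (α⁻¹ • A) ∪ (β⁻¹ • B) ∪ (σ⁻¹ • E) ⊆ boxR n R := by
    obtain ⟨R, hR⟩ := ((cA.union cB).union cE).isBounded.exists_norm_le
    refine ⟨R, fun x hx => ?_⟩
    have := fun i => abs_le.1 ((norm_le_pi_norm x i).trans (hR x hx))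
    exact ⟨fun i => (this i).1, fun i => (this i).2⟩
  have key := bmn n R (a * α / σ) (b * β / σ) (by positivity) (by positivity)
    (by rw [← add_div, div_self hσp.ne']) (α⁻¹ • A) (β⁻¹ • B) (σ⁻¹ • E)
    cA.measurableSet cB.measurableSet cE.measurableSet
    (fun x hx => hR (Or.inl (Or.inl hx))) (fun x hx => hR (Or.inl (Or.inr hx)))
    (fun x hx => hR (Or.inr hx)) (by
      rintro _ ⟨x, hx, rfl⟩ _ ⟨y, hy, rfl⟩
      refine ⟨_, h x hx y hy, ?_⟩
      simp only [smul_add, smul_smul]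
      congr 2 <;> field_simp)
  rw [hsm _ _ (by positivity), hsm _ _ (by positivity), hsm _ _ (by positivity), ← hαn, ← hβn,
    ← mul_pow, ← mul_pow, inv_mul_cancel₀ hαp.ne', inv_mul_cancel₀ hβp.ne', one_pow,
    Real.one_rpow, Real.one_rpow, one_mul, inv_pow, ← div_eq_inv_mul, one_le_div (by positivity)] at key
  calc σ = (σ ^ n) ^ (1 / n : ℝ) := (hroot σ hσp.le).symm
    _ ≤ _ := Real.rpow_le_rpow (by positivity) key (by positivity)

def TT {n : ℕ} (K : Set (Fin n → ℝ)) (z : Fin n → ℝ) : Set (Fin n → ℝ) := {y | y ∈ K ∧ z - y ∈ K}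

lemma TT_compact {n : ℕ} {K : Set (Fin n → ℝ)} (hK : IsCompact K) (z : Fin n → ℝ) :
    IsCompact (TT K z) :=
  hK.inter_right (hK.isClosed.preimage (continuous_const.sub continuous_id))

lemma TT_cont {n : ℕ} {K : Set (Fin n → ℝ)} (hK : IsCompact K) (hc : Convex ℝ K) :
    Continuous fun z => volume.real (TT K z) := by
  have e : (fun z => volume.real (TT K z)) =
      fun z => ∫ y, K.indicator (fun _ => (1:ℝ)) y * K.indicator (fun _ => (1:ℝ)) (z - y) := by
    ext z
    rw [← integral_indicator_one (TT_compact hK z).measurableSet]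
    congr 1
    ext y
    by_cases h1 : y ∈ K <;> by_cases h2 : z - y ∈ K <;> simp [indicator, TT, h1, h2]
  rw [e, continuous_iff_continuousAt]
  intro z0
  have hm : Measurable (K.indicator (fun _ => (1:ℝ))) := measurable_const.indicator hK.measurableSet
  apply continuousAt_of_dominated (bound := K.indicator (fun _ => (1:ℝ)))
  · refine .of_forall fun z => Measurable.aestronglyMeasurable ?_
    exact hm.mul (hm.comp (measurable_const.sub measurable_id))
  · refine .of_forall fun z => .of_forall fun y => ?_
    by_cases h1 : y ∈ K <;> by_cases h2 : z - y ∈ K <;> simp [indicator, h1, h2]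
  · rw [integrable_indicator_iff hK.measurableSet]
    exact integrableOn_const hK.measure_ne_top
  · have hn : ∀ᵐ y : Fin n → ℝ, y ∉ frontier K := by
      rw [ae_iff]; simpa using hc.addHaar_frontier volume
    have hn' := (Measure.measurePreserving_sub_left (volume : Measure (Fin n → ℝ)) z0).quasiMeasurePreserving.ae hn
    filter_upwards [hn'] with y hy
    apply ContinuousAt.mul continuousAt_const
    have : ContinuousAt (K.indicator (fun _ => (1:ℝ))) (z0 - y) :=
      continuousOn_const.continuousAt_indicator hy
    exact ContinuousAt.comp (f := fun z => z - y) this (by fun_prop)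

lemma TT_conv {n : ℕ} {K : Set (Fin n → ℝ)} (hK : IsCompact K) (F : (Fin n → ℝ) → ENNReal)
    (hF : Measurable F) :
    ∫⁻ p, F (p.1 + p.2) ∂((volume.restrict K).prod (volume.restrict K)) =
      ∫⁻ z, F z * volume (TT K z) := by
  have hm : Measurable (K.indicator (fun _ => (1:ENNReal))) := measurable_const.indicator hK.measurableSet
  rw [lintegral_prod _ (by fun_prop), ← lintegral_indicator hK.measurableSet]
  have : ∀ x, K.indicator (fun x => ∫⁻ y in K, F (x + y)) x =
      ∫⁻ z, K.indicator (fun _ => (1:ENNReal)) x * K.indicator (fun _ => (1:ENNReal)) (z - x) * F z := by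
    intro x
    rw [← lintegral_add_left_eq_self _ x]
    simp only [add_sub_cancel_left]
    by_cases hx : x ∈ K
    · simp only [hx, indicator_of_mem, one_mul]
      rw [← lintegral_indicator hK.measurableSet]
      congr 1; ext y
      by_cases hy : y ∈ K <;> simp [hy]
    · simp [hx]
  simp_rw [this]
  rw [lintegral_lintegral_swap]
  · congr 1
    ext z
    rw [lintegral_mul_const]
    · rw [mul_comm, ← lintegral_indicator_one (TT_compact hK z).measurableSet]
      congr 2
      ext y
      by_cases h1 : y ∈ K <;> by_cases h2 : z - y ∈ K <;> simp [indicator, TT, h1, h2]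
    · exact hm.mul (hm.comp (measurable_const.sub measurable_id))
  · apply Measurable.aemeasurable
    exact ((hm.comp measurable_fst).mul (hm.comp (measurable_snd.sub measurable_fst))).mul
      (hF.comp measurable_snd)

lemma tangent {d : ℕ} (hd : d ≠ 0) (c u : ℝ) (hc : 0 < c) (hu : 0 ≤ u) :
    c ^ (1 / d : ℝ) * ((1 + 1 / d) * u - c / d) ≤ u ^ (1 / d : ℝ) * u ∧
    (u ≠ c → c ^ (1 / d : ℝ) * ((1 + 1 / d) * u - c / d) < u ^ (1 / d : ℝ) * u) := by
  have hd' : (0 : ℝ) < d := by positivity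
  have e1 : u ^ (1 / d : ℝ) * u = c ^ (1 / d : ℝ) * c * (1 + (u / c - 1)) ^ (1 + 1 / d : ℝ) := by
    rw [add_sub_cancel, Real.rpow_one_add' (by positivity) (by positivity),
      Real.div_rpow hu hc.le]
    have : c ^ (1 / d : ℝ) ≠ 0 := by positivity
    field_simp
  have e2 : c ^ (1 / d : ℝ) * ((1 + 1 / d) * u - c / d) =
      c ^ (1 / d : ℝ) * c * (1 + (1 + 1 / d) * (u / c - 1)) := by
    field_simp; ring
  have hp : 0 < c ^ (1 / d : ℝ) * c := by positivity
  have hs : -1 ≤ u / c - 1 := by linarith [div_nonneg hu hc.le]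
  rw [e1, e2]
  constructor
  · exact mul_le_mul_of_nonneg_left (one_add_mul_self_le_rpow_one_add hs (by simp)) hp.le
  · intro hne
    refine mul_lt_mul_of_pos_left (one_add_mul_self_lt_rpow_one_add hs ?_ (by simpa using hd')) hp
    intro h0
    apply hne
    have : u / c = 1 := by linarith
    rwa [div_eq_one_iff_eq hc.ne'] at this

lemma milman_pajor {d : ℕ} (hd : d ≠ 0) (K : Set (Fin d → ℝ))
    (hK : IsCompact K) (hKc : Convex ℝ K) (hKint : (interior K).Nonempty)
    (hcent : (⨍ x in K, x) = (0 : Fin d → ℝ)) :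
    volume.real K / 2 ^ d < volume.real (TT K 0) := by
  have hVt : volume K ≠ ⊤ := hK.measure_ne_top
  have hV0 : volume K ≠ 0 := ((isOpen_interior.measure_pos volume hKint).trans_le (measure_mono interior_subset)).ne'
  have hV : 0 < volume.real K := ENNReal.toReal_pos hV0 hVt
  have hKn : K.Nonempty := hKint.mono interior_subset
  set V := volume.real K with hVdef
  set c := V / 2 ^ d with hcdef
  have hc : 0 < c := by positivity
  set g : (Fin d → ℝ) → ℝ := fun z => volume.real (TT K z) with hg
  have hgc : Continuous g := TT_cont hK hKc
  have hg0 : ∀ z, 0 ≤ g z := fun z => by positivity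
  have hd' : (0 : ℝ) < d := by positivity
  set φ : (Fin d → ℝ) → ℝ := fun z => g z ^ (1 / d : ℝ) with hφ
  have hφc : Continuous φ := hgc.rpow_const (fun _ => Or.inr (by positivity))
  have hφ0 : ∀ z, 0 ≤ φ z := fun z => Real.rpow_nonneg (hg0 z) _
  set s := K + K with hs
  have hsK : IsCompact s := hK.add hK
  have hsc : Convex ℝ s := hKc.add hKc
  have hsT : ∀ z, z ∈ s ↔ (TT K z).Nonempty := by
    intro z
    constructor
    · rintro ⟨x, hx, y, hy, rfl⟩
      exact ⟨x, hx, by simpa using hy⟩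
    · rintro ⟨x, hx, hy⟩
      exact ⟨x, hx, _, hy, by simp⟩
  have hgs : ∀ z, z ∉ s → g z = 0 := by
    intro z hz
    rw [hsT, not_nonempty_iff_eq_empty] at hz
    simp [hg, hz]
  have hsV : volume.real s = 2 ^ d * V := by
    have : s = (2:ℝ) • K := by
      have := hKc.add_smul (zero_le_one' ℝ) (zero_le_one' ℝ)
      rw [one_smul] at this
      rw [hs, ← this]; norm_num
    rw [this, measureReal_def, Measure.addHaar_smul, ENNReal.toReal_mul, hVdef, measureReal_def]
    simp
  have hconc : ConcaveOn ℝ s φ := by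
    rw [concaveOn_iff_forall_pos]
    refine ⟨hsc, ?_⟩
    intro x hx y hy a b ha hb hab
    apply bm_dim d hd a b ha hb _ _ _ (TT_compact hK x) (TT_compact hK y) (TT_compact hK _)
      ((hsT x).1 hx) ((hsT y).1 hy)
    intro u hu v hv
    refine ⟨hKc hu.1 hv.1 ha.le hb.le hab, ?_⟩
    have := hKc hu.2 hv.2 ha.le hb.le hab
    convert this using 1
    simp only [smul_sub]; abel
  set μ := (volume.restrict K).prod (volume.restrict K) with hμ
  have hμ' : μ = volume.restrict (K ×ˢ K) := by
    rw [hμ, Measure.prod_restrict]; rfl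
  have hint : ∀ {G : Type} [NormedAddCommGroup G] (f : (Fin d → ℝ) × (Fin d → ℝ) → G),
      Continuous f → Integrable f μ := by
    intro G _ f hf
    rw [hμ']
    exact hf.continuousOn.integrableOn_compact (hK.prod hK)
  have : IsFiniteMeasure (volume.restrict K) := ⟨by simpa using hVt.lt_top⟩
  have hμu : μ.real univ = V * V := by
    rw [hμ, ← univ_prod_univ, measureReal_prod_prod]
    simp [hVdef]
  have : NeZero μ := ⟨by
    intro h
    rw [h] at hμu
    simp at hμu
    exact hV.ne' hμu⟩
  have hI0 : ∫ x in K, x = (0 : Fin d → ℝ) := by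
    rw [setAverage_eq] at hcent
    rcases smul_eq_zero.1 hcent with h | h
    · exact absurd (inv_eq_zero.1 h) hV.ne'
    · exact h
  have hbar : ∫ p, (p.1 + p.2) ∂μ = (0 : Fin d → ℝ) := by
    rw [integral_add (hint _ continuous_fst) (hint _ continuous_snd), hμ, integral_prod, integral_prod]
    · simp only [integral_const, hI0]
      rw [integral_smul, hI0, smul_zero, add_zero]
    · exact hint _ continuous_snd
    · exact hint _ continuous_fst
  have jen := hconc.le_map_average (μ := μ) (f := fun p => p.1 + p.2) hφc.continuousOn hsK.isClosed
    (by
      rw [hμ', ae_restrict_iff' (hK.prod hK).measurableSet]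
      exact .of_forall fun p hp => ⟨_, hp.1, _, hp.2, rfl⟩)
    (hint _ (by fun_prop)) (hint _ (by fun_prop))
  rw [average_eq, average_eq, hbar, smul_zero, hμu, smul_eq_mul] at jen
  -- convolution identity
  have conv : ∀ F : (Fin d → ℝ) → ℝ, Continuous F → (∀ z, 0 ≤ F z) →
      ∫ p, F (p.1 + p.2) ∂μ = ∫ z, F z * g z := by
    intro F hF hF0
    rw [integral_eq_lintegral_of_nonneg_ae (.of_forall fun p => hF0 _)
      (Continuous.aestronglyMeasurable (by fun_prop)),
      integral_eq_lintegral_of_nonneg_ae (.of_forall fun z => mul_nonneg (hF0 _) (hg0 _))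
      (Continuous.aestronglyMeasurable (by fun_prop)),
      TT_conv hK (fun z => ENNReal.ofReal (F z)) (by fun_prop)]
    congr 2
    ext z
    rw [ENNReal.ofReal_mul (hF0 z)]
    congr 1
    exact (ENNReal.ofReal_toReal (TT_compact hK z).measure_ne_top).symm
  have hgint : ∫ z, g z = V * V := by
    have := conv (fun _ => 1) continuous_const (by simp)
    simp only [one_mul] at this
    rw [← this]; simp [hμu]
  have hφg : ∫ z, φ z * g z = ∫ z in s, φ z * g z := by
    rw [setIntegral_eq_integral_of_forall_compl_eq_zero]
    intro z hz; simp [hgs z hz]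
  have hgg : ∫ z in s, g z = V * V := by
    rw [setIntegral_eq_integral_of_forall_compl_eq_zero hgs, hgint]
  have hios : ∀ f : (Fin d → ℝ) → ℝ, Continuous f → IntegrableOn f s := fun f hf =>
    hf.continuousOn.integrableOn_compact hsK
  -- the open set where strictness holds
  set U : Set (Fin d → ℝ) := {z | 0 < g z ∧ g z < c} with hU
  have hUo : IsOpen U := (isOpen_lt continuous_const hgc).inter (isOpen_lt hgc continuous_const)
  have hUn : U.Nonempty := by
    by_contra hne
    rw [not_nonempty_iff_eq_empty] at hne
    have e : {z | g z ≤ 0} = {z | g z < c} := by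
      ext z
      constructor
      · intro h; exact lt_of_le_of_lt h hc
      · intro h
        by_contra h'
        have : z ∈ U := ⟨not_le.1 h', h⟩
        rw [hne] at this; exact this
    have hclopen : IsClopen {z | g z ≤ 0} :=
      ⟨isClosed_le hgc continuous_const, e ▸ isOpen_lt hgc continuous_const⟩
    rcases isClopen_iff.1 hclopen with h | h
    · have : NeZero d := ⟨hd⟩
      have : Nontrivial (Fin d → ℝ) := inferInstance
      have : NoncompactSpace (Fin d → ℝ) := NormedSpace.noncompactSpace ℝ _
      obtain ⟨z, hz⟩ := (ne_univ_iff_exists_notMem s).1 hsK.ne_univ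
      have : z ∈ {z | g z ≤ 0} := (hgs z hz).le
      rw [h] at this; exact this
    · have h0 : ∀ z, g z = 0 := fun z => le_antisymm (by
        have : z ∈ {z | g z ≤ 0} := by rw [h]; trivial
        exact this) (hg0 z)
      simp only [h0, integral_zero] at hgint
      have : 0 < V * V := by positivity
      linarith
  have hUs : U ⊆ s := by
    intro z hz
    by_contra h
    exact hz.1.ne' (hgs z h)
  have strict : 0 < ∫ z in s, (φ z * g z - c ^ (1 / d : ℝ) * ((1 + 1 / d) * g z - c / d)) := by
    rw [setIntegral_pos_iff_support_of_nonneg_ae]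
    · refine lt_of_lt_of_le (hUo.measure_pos volume hUn) (measure_mono fun z hz => ⟨?_, hUs hz⟩)
      exact (sub_pos.2 ((tangent hd c (g z) hc (hg0 z)).2 hz.2.ne)).ne'
    · exact .of_forall fun z => sub_nonneg.2 (tangent hd c (g z) hc (hg0 z)).1
    · exact hios _ (by fun_prop)
  rw [integral_sub (hios _ (by fun_prop)) (hios _ (by fun_prop)), integral_const_mul,
    integral_sub (hios _ (by fun_prop)) (hios _ (by fun_prop)), integral_const_mul, hgg, ← hφg,
    setIntegral_const, hsV, smul_eq_mul] at strict
  have hcv : (1 + 1 / d) * (V * V) - 2 ^ d * V * (c / d) = V * V := by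
    rw [hcdef]; field_simp; ring
  rw [hcv] at strict
  rw [conv φ hφc hφ0] at jen
  have h1 : c ^ (1 / d : ℝ) < φ 0 := by
    refine lt_of_lt_of_le ?_ jen
    rw [← div_eq_inv_mul, lt_div_iff₀ (by positivity)]
    linarith
  exact (Real.rpow_lt_rpow_iff hc.le (hg0 0) (by positivity)).1 h1

/-- **Proposition 1.** If `K ⊆ ℝ^d` is a convex body (compact, convex, nonempty interior)
whose centroid is the origin, and `λ₁` is its first successive minimum (the least `λ > 0`
such that `λK` contains a nonzero integer point), then
`#(K ∩ ℤ^d) < 2^d (2/λ₁ + 1)^d`. -/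
theorem lattice_point_bound_centroid (d : ℕ) (K : Set (Fin d → ℝ))
    (hKcpt : IsCompact K) (hKconv : Convex ℝ K) (hKint : (interior K).Nonempty)
    (hcent : (⨍ x in K, x) = (0 : Fin d → ℝ))
    (l1 : ℝ)
    (hl1 : IsLeast {l : ℝ | 0 < l ∧ ∃ z : Fin d → ℤ,
      (fun i => (z i : ℝ)) ≠ 0 ∧ (fun i => (z i : ℝ)) ∈ l • K} l1) :
    (Set.ncard (K ∩ latticePts d) : ℝ) < 2 ^ d * (2 / l1 + 1) ^ d := by
  obtain ⟨⟨hl, z0, hz0, -⟩, hmin⟩ := hl1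
  have hd : d ≠ 0 := by
    rintro rfl
    exact hz0 (Subsingleton.elim _ _)
  have mp := milman_pajor hd K hKcpt hKconv hKint hcent
  by_cases hfin : (K ∩ latticePts d).Finite
  swap
  · rw [Set.Infinite.ncard hfin]
    have : 0 < 2 / l1 + 1 := by positivity
    simp only [Nat.cast_zero]; positivity
  set r := l1 / 2 with hr
  have hrp : 0 < r := by positivity
  set S := TT K 0 with hS
  have hSK : S ⊆ K := fun x hx => hx.1
  have hSc : Convex ℝ S := by
    intro x hx y hy a b ha hb hab
    refine ⟨hKconv hx.1 hy.1 ha hb hab, ?_⟩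
    have := hKconv hx.2 hy.2 ha hb hab
    convert this using 1
    simp only [smul_sub, smul_zero]; abel
  have hSneg : ∀ x ∈ interior S, -x ∈ interior S := by
    intro x hx
    have h1 : -S = S := by
      ext y; simp [hS, TT, and_comm]
    have h2 : -interior S = interior S := by
      have := (Homeomorph.neg (Fin d → ℝ)).preimage_interior S
      simpa [h1] using this
    rw [← h2]; simpa using hx
  have hvolS : volume (interior S) = volume S :=
    measure_interior_of_null_frontier (hSc.addHaar_frontier volume)
  set O := r • interior S with hO
  have hOo : IsOpen O := isOpen_interior.smul₀ hrp.ne'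
  have hOv : volume.real O = r ^ d * volume.real S := by
    rw [measureReal_def, Measure.addHaar_smul, ENNReal.toReal_mul, hvolS, measureReal_def]
    simp only [Module.finrank_fintype_fun_eq_card, Fintype.card_fin, abs_of_nonneg (pow_nonneg hrp.le d)]
    rw [ENNReal.toReal_ofReal (pow_nonneg hrp.le d)]
  set P := hfin.toFinset with hP
  have hdisj : (P : Set (Fin d → ℝ)).PairwiseDisjoint (fun x => x +ᵥ O) := by
    intro x hx y hy hxy
    rw [Function.onFun, Set.disjoint_left]
    rintro w ⟨_, ⟨u, hu, rfl⟩, hw1⟩ ⟨_, ⟨v, hv, rfl⟩, hw2⟩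
    have hx' : x ∈ K ∩ latticePts d := by simpa [hP] using hx
    have hy' : y ∈ K ∩ latticePts d := by simpa [hP] using hy
    have hxyz : x - y = l1 • ((1/2 : ℝ) • v + (1/2 : ℝ) • (-u)) := by
      have e : x + r • u = y + r • v := by
        simpa using hw1.trans hw2.symm
      have : x - y = r • v - r • u := by
        rw [sub_eq_sub_iff_add_eq_add, e]; abel
      rw [this, hr]
      ext i; simp; ring
    set q := (1/2 : ℝ) • v + (1/2 : ℝ) • (-u) with hq
    have hqS : q ∈ interior K := interior_mono hSK
      (hSc.interior hv (hSneg u hu) (by norm_num) (by norm_num) (by norm_num))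
    -- enlarge
    obtain ⟨ε, hε, hεK⟩ : ∃ ε : ℝ, 0 < ε ∧ (1 + ε) • q ∈ K := by
      have hcont : Continuous fun ε : ℝ => (1 + ε) • q := by fun_prop
      have hn : (fun ε : ℝ => (1 + ε) • q) ⁻¹' (interior K) ∈ nhds (0 : ℝ) := by
        apply hcont.continuousAt.preimage_mem_nhds
        simpa using isOpen_interior.mem_nhds hqS
      obtain ⟨δ, hδ, hb⟩ := Metric.mem_nhds_iff.1 hn
      refine ⟨δ / 2, by positivity, interior_subset (hb ?_)⟩
      simp [abs_of_pos hδ, hδ]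
    choose zx hzx using hx'.2
    choose zy hzy using hy'.2
    have hz : (fun i => ((zx i - zy i : ℤ) : ℝ)) = x - y := by
      ext i; simp [hzx, hzy]
    have := hmin (show l1 / (1 + ε) ∈ _ from ⟨by positivity, fun i => zx i - zy i, by
      rw [hz]; exact sub_ne_zero.2 hxy, by
      rw [hz, hxyz]
      refine ⟨_, hεK, ?_⟩
      simp only [smul_smul]
      congr 1; field_simp⟩)
    rw [le_div_iff₀ (by positivity)] at this
    nlinarith
  have hsub : (⋃ x ∈ P, (x +ᵥ O)) ⊆ (1 + r) • K := by
    rw [hKconv.add_smul zero_le_one hrp.le, one_smul]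
    intro w hw
    simp only [mem_iUnion] at hw
    obtain ⟨x, hx, _, ⟨u, hu, rfl⟩, rfl⟩ := hw
    have hx' : x ∈ K ∩ latticePts d := by simpa [hP] using hx
    exact ⟨x, hx'.1, _, ⟨u, hSK (interior_subset hu), rfl⟩, rfl⟩
  have hfinO : ∀ x : Fin d → ℝ, volume (x +ᵥ O) ≠ ⊤ := by
    intro x
    rw [measure_vadd]
    exact ne_top_of_le_ne_top (hKcpt.smul r).measure_ne_top
      (measure_mono (smul_set_mono (interior_subset.trans hSK)))
  have hmeas : volume.real (⋃ x ∈ P, (x +ᵥ O)) = P.card * (r ^ d * volume.real S) := by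
    rw [measureReal_biUnion_finset hdisj (fun x _ => (hOo.vadd x).measurableSet) (fun x _ => hfinO x)]
    · have : ∀ x : Fin d → ℝ, volume.real (x +ᵥ O) = r ^ d * volume.real S := fun x => by
        rw [← hOv, measureReal_def, measure_vadd, measureReal_def]
      simp [this]
  have hle : (P.card : ℝ) * (r ^ d * volume.real S) ≤ (1 + r) ^ d * volume.real K := by
    rw [← hmeas]
    refine (measureReal_mono hsub (hKcpt.smul _).measure_ne_top).trans (le_of_eq ?_)
    have h1r : 0 ≤ 1 + r := by positivity
    rw [measureReal_def, Measure.addHaar_smul, ENNReal.toReal_mul, measureReal_def]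
    simp only [Module.finrank_fintype_fun_eq_card, Fintype.card_fin, abs_of_nonneg (pow_nonneg h1r d)]
    rw [ENNReal.toReal_ofReal (pow_nonneg h1r d)]
  rw [Set.ncard_eq_toFinset_card _ hfin]
  change (P.card : ℝ) < _
  have hV : 0 ≤ volume.real K := by positivity
  have hSp : 0 < volume.real S := lt_of_le_of_lt (by positivity) mp
  rw [div_lt_iff₀ (by positivity)] at mp
  have hlt : (P.card : ℝ) * (r ^ d * volume.real S) <
      2 ^ d * (2 / l1 + 1) ^ d * (r ^ d * volume.real S) := by
    refine lt_of_le_of_lt hle ?_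
    have e : (2 / l1 + 1) ^ d * r ^ d = (1 + r) ^ d := by
      rw [← mul_pow]; congr 1; rw [hr]; field_simp
    calc _ < (1 + r) ^ d * (volume.real S * 2 ^ d) := by gcongr
      _ = _ := by rw [← e]; ring
  exact lt_of_mul_lt_mul_right hlt (by positivity)
end

section
/- Let K be a convex body in ℝ^d with centroid at the origin such that the origin is the only interior lattice point of K, i.e., int(K) ∩ ℤ^d = {0}. Then #(K ∩ ℤ^d) < 6^d. -/
open MeasureTheory Set Pointwise

open scoped ENNReal

lemma aux_add_compact {A B C : Set ℝ} (hA : IsCompact A) (hB : IsCompact B)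
    (hA0 : A.Nonempty) (hB0 : B.Nonempty) 
    (h : ∀ x ∈ A, ∀ y ∈ B, x + y ∈ C) : volume A + volume B ≤ volume C := by
  obtain ⟨a, ha, hamax⟩ := hA.exists_isGreatest hA0
  obtain ⟨b, hb, hbmin⟩ := hB.exists_isLeast hB0
  have h1 : volume ((fun x => x + b) '' A) = volume A := by
    rw [image_add_right]; simp
  have h2 : volume ((fun y => a + y) '' B) = volume B := by
    rw [image_add_left]; simp
  rw [← h1, ← h2, ← measure_union₀']
  · apply measure_mono
    rintro _ (⟨x, hx, rfl⟩ | ⟨y, hy, rfl⟩)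
    · exact h _ hx _ hb
    · exact h _ ha _ hy
  · exact ((hA.image (by fun_prop)).measurableSet).nullMeasurableSet
  · apply measure_mono_null (t := {a + b})
    · rintro _ ⟨⟨x, hx, rfl⟩, ⟨y, hy, hxy⟩⟩
      have := hamax hx
      have := hbmin hy
      simp only [mem_singleton_iff] at *
      linarith
    · simp

lemma aux_add_meas {A B C : Set ℝ} (hA : MeasurableSet A) (hB : MeasurableSet B)
    (hA0 : A.Nonempty) (hB0 : B.Nonempty) 
    (h : ∀ x ∈ A, ∀ y ∈ B, x + y ∈ C) : volume A + volume B ≤ volume C := by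
  obtain ⟨a, ha⟩ := hA0
  obtain ⟨b, hb⟩ := hB0
  rw [hA.measure_eq_iSup_isCompact, hB.measure_eq_iSup_isCompact]
  simp only [iSup_and']
  refine ENNReal.biSup_add_biSup_le' ⟨∅, by simp⟩ ⟨∅, by simp⟩ ?_
  rintro A' ⟨hA', hA'c⟩ B' ⟨hB', hB'c⟩
  calc volume A' + volume B' ≤ volume (insert a A') + volume (insert b B') := by
        gcongr <;> exact subset_insert _ _
    _ ≤ volume C := by
        apply aux_add_compact (hA'c.insert a) (hB'c.insert b) (insert_nonempty _ _)
          (insert_nonempty _ _)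
        intro x hx y hy
        exact h x (insert_subset ha hA' hx) y (insert_subset hb hB' hy)

lemma aux_layer {F : ℝ → ℝ≥0∞} (hF : Measurable F) :
    ∫⁻ x, F x = ∫⁻ t in Ioi (0:ℝ), volume {x | ENNReal.ofReal t < F x} := by
  have hm : MeasurableSet {p : ℝ × ℝ | ENNReal.ofReal p.1 < F p.2} :=
    measurableSet_lt (by fun_prop) (by fun_prop)
  have h1 : ∀ t : ℝ, volume {x | ENNReal.ofReal t < F x} =
      ∫⁻ x, {p : ℝ × ℝ | ENNReal.ofReal p.1 < F p.2}.indicator 1 (t, x) := by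
    intro t
    rw [← lintegral_indicator_one (measurableSet_lt (by fun_prop) (by fun_prop))]
    rfl
  simp_rw [h1]
  rw [lintegral_lintegral_swap]
  · congr 1
    ext x
    have h2 : ∀ t : ℝ, {p : ℝ × ℝ | ENNReal.ofReal p.1 < F p.2}.indicator (1 : ℝ × ℝ → ℝ≥0∞) (t, x)
      = {t : ℝ | ENNReal.ofReal t < F x}.indicator 1 t := fun t => rfl
    simp_rw [h2]
    rw [lintegral_indicator_one (measurableSet_lt (by fun_prop) (by fun_prop)),
      Measure.restrict_apply (measurableSet_lt (by fun_prop) (by fun_prop))]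
    by_cases hx : F x = ∞
    · simp [hx]
    · have : {t : ℝ | ENNReal.ofReal t < F x} ∩ Ioi 0 = Ioo 0 (F x).toReal := by
        ext t
        simp only [mem_inter_iff, mem_ofPred_eq, mem_Ioi, mem_Ioo]
        constructor
        · rintro ⟨h, h0⟩
          exact ⟨h0, (ENNReal.ofReal_lt_iff_lt_toReal h0.le hx).1 h⟩
        · rintro ⟨h0, h⟩
          exact ⟨(ENNReal.ofReal_lt_iff_lt_toReal h0.le hx).2 h, h0⟩
      rw [this]
      simp [hx]
  · exact (measurable_const.indicator hm).aemeasurable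

lemma aux_pl1_norm {f g h : ℝ → ℝ≥0∞} (hf : Measurable f) (hg : Measurable g) (hh : Measurable h)
    (hf1 : ⨆ x, f x = 1) (hg1 : ⨆ x, g x = 1)
    (H : ∀ x y, f x * g y ≤ h ((1/2 : ℝ) • (x + y)) ^ 2) :
    (∫⁻ x, f x) + (∫⁻ x, g x) ≤ 2 * ∫⁻ x, h x := by
  rw [aux_layer hf, aux_layer hg, aux_layer hh, ← lintegral_const_mul']
  swap
  · simp
  rw [← lintegral_add_left']
  swap
  · refine Measurable.aemeasurable (Antitone.measurable ?_)
    intro s t hst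
    apply measure_mono
    intro x hx
    exact lt_of_le_of_lt (ENNReal.ofReal_le_ofReal hst) hx
  apply setLIntegral_mono' measurableSet_Ioi
  intro t ht
  by_cases ht1 : ENNReal.ofReal t < 1
  · have hA : ({x | ENNReal.ofReal t < f x}).Nonempty := by
      rw [← hf1] at ht1; exact lt_iSup_iff.1 ht1
    have hB : ({x | ENNReal.ofReal t < g x}).Nonempty := by
      rw [← hg1] at ht1; exact lt_iSup_iff.1 ht1
    have : 2 * volume {x | ENNReal.ofReal t < h x} = volume ((2:ℝ) • {x | ENNReal.ofReal t < h x}) := by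
      rw [Measure.addHaar_smul]; simp
    rw [this]
    apply aux_add_meas (measurableSet_lt (by fun_prop) (by fun_prop))
      (measurableSet_lt (by fun_prop) (by fun_prop)) hA hB
    intro x hx y hy
    refine ⟨(1/2 : ℝ) • (x + y), ?_, by simp⟩
    have h1 : ENNReal.ofReal t * ENNReal.ofReal t < f x * g y := ENNReal.mul_lt_mul hx hy
    have h2 := h1.trans_le (H x y)
    rw [← pow_two] at h2
    exact lt_of_pow_lt_pow_left' 2 h2
  · have hA : {x | ENNReal.ofReal t < f x} = ∅ := by
      ext x
      have := le_iSup f x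
      simp only [mem_ofPred_eq, mem_empty_iff_false, iff_false]
      intro h
      exact ht1 (h.trans_le (this.trans hf1.le))
    have hB : {x | ENNReal.ofReal t < g x} = ∅ := by
      ext x
      have := le_iSup g x
      simp only [mem_ofPred_eq, mem_empty_iff_false, iff_false]
      intro h
      exact ht1 (h.trans_le (this.trans hg1.le))
    simp [hA, hB]

lemma aux_amgm (a b : ℝ≥0∞) : 4 * (a * b) ≤ (a + b) ^ 2 := by
  by_cases ha : a = ∞
  · simp [ha]
  by_cases hb : b = ∞
  · simp [hb]
  lift a to NNReal using ha
  lift b to NNReal using hb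
  have : 4 * (a * b) ≤ (a + b) ^ 2 := by
    rw [← NNReal.coe_le_coe]
    push_cast
    nlinarith [sq_nonneg ((a:ℝ) - b)]
  exact_mod_cast this

lemma aux_pl1_bdd {f g h : ℝ → ℝ≥0∞} (hf : Measurable f) (hg : Measurable g) (hh : Measurable h)
    (hf1 : ⨆ x, f x ≠ ∞) (hg1 : ⨆ x, g x ≠ ∞)
    (H : ∀ x y, f x * g y ≤ h ((1/2 : ℝ) • (x + y)) ^ 2) :
    (∫⁻ x, f x) * (∫⁻ x, g x) ≤ (∫⁻ x, h x) ^ 2 := by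
  set a := ⨆ x, f x with ha
  set b := ⨆ x, g x with hb
  by_cases ha0 : a = 0
  · have : ∀ x, f x = 0 := fun x => by
      have := le_iSup f x
      rw [← ha, ha0] at this
      simpa using this
    simp [this]
  by_cases hb0 : b = 0
  · have : ∀ x, g x = 0 := fun x => by
      have := le_iSup g x
      rw [← hb, hb0] at this
      simpa using this
    simp [this]
  set c : ℝ≥0∞ := (a⁻¹ * b⁻¹) ^ (1/2 : ℝ) with hc
  have hc2 : c ^ 2 = a⁻¹ * b⁻¹ := by
    rw [hc, ← ENNReal.rpow_natCast, ← ENNReal.rpow_mul]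
    norm_num
  have key := aux_pl1_norm (f := fun x => a⁻¹ * f x) (g := fun x => b⁻¹ * g x)
    (h := fun x => c * h x) (by fun_prop) (by fun_prop) (by fun_prop)
    (by rw [← ENNReal.mul_iSup]; exact ENNReal.inv_mul_cancel ha0 hf1)
    (by rw [← ENNReal.mul_iSup]; exact ENNReal.inv_mul_cancel hb0 hg1)
    (by
      intro x y
      rw [mul_pow, hc2]
      calc a⁻¹ * f x * (b⁻¹ * g y) = a⁻¹ * b⁻¹ * (f x * g y) := by ring
        _ ≤ _ := by gcongr; exact H x y)
  rw [lintegral_const_mul _ hf, lintegral_const_mul _ hg, lintegral_const_mul _ hh] at key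
  set If := ∫⁻ x, f x
  set Ig := ∫⁻ x, g x
  set Ih := ∫⁻ x, h x
  have h3 := (aux_amgm (a⁻¹ * If) (b⁻¹ * Ig)).trans (pow_le_pow_left' key 2)
  have h4 : (4 * (a⁻¹ * b⁻¹)) * (If * Ig) ≤ (4 * (a⁻¹ * b⁻¹)) * Ih ^ 2 := by
    calc _ = 4 * (a⁻¹ * If * (b⁻¹ * Ig)) := by ring
      _ ≤ _ := h3
      _ = _ := by rw [mul_pow, mul_pow, hc2]; ring
  refine (ENNReal.mul_le_mul_iff_right ?_ ?_).1 h4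
  · simp [hf1, hg1]
  · apply ENNReal.mul_ne_top (by simp)
    apply ENNReal.mul_ne_top <;> simp [ha0, hb0]

lemma aux_pl1 {f g h : ℝ → ℝ≥0∞} (hf : Measurable f) (hg : Measurable g) (hh : Measurable h)
    (H : ∀ x y, f x * g y ≤ h ((1/2 : ℝ) • (x + y)) ^ 2) :
    (∫⁻ x, f x) * (∫⁻ x, g x) ≤ (∫⁻ x, h x) ^ 2 := by
  have trunc : ∀ F : ℝ → ℝ≥0∞, Measurable F →
      ∫⁻ x, F x = ⨆ n : ℕ, ∫⁻ x, min (F x) n := by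
    intro F hF
    rw [← lintegral_iSup]
    · congr 1; ext x
      rw [← inf_iSup_eq, ENNReal.iSup_natCast]; simp
    · intro n; fun_prop
    · intro m n hmn x
      simp only
      gcongr
  rw [trunc f hf, trunc g hg]
  rw [ENNReal.iSup_mul]
  apply iSup_le
  intro m
  rw [ENNReal.mul_iSup]
  apply iSup_le
  intro n
  apply aux_pl1_bdd (by fun_prop) (by fun_prop) hh
  · exact ne_top_of_le_ne_top (ENNReal.natCast_ne_top m) (iSup_le fun x => min_le_right _ _)
  · exact ne_top_of_le_ne_top (ENNReal.natCast_ne_top n) (iSup_le fun x => min_le_right _ _)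
  · intro x y
    refine le_trans ?_ (H x y)
    gcongr <;> exact min_le_left _ _

lemma aux_fubini (n : ℕ) {f : (Fin (n+1) → ℝ) → ℝ≥0∞} (hf : Measurable f) :
    ∫⁻ x, f x = ∫⁻ t : ℝ, ∫⁻ x : Fin n → ℝ, f (Fin.cons t x) := by
  have := (volume_preserving_piFinSuccAbove (fun _ : Fin (n + 1) => ℝ) 0).symm
  rw [← this.lintegral_comp hf, Measure.volume_eq_prod, lintegral_prod]
  · simp [MeasurableEquiv.piFinSuccAbove_symm_apply, Fin.insertNthEquiv, Fin.insertNth_zero']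
  · exact (hf.comp (MeasurableEquiv.measurable _)).aemeasurable

lemma aux_cons_meas (n : ℕ) : Measurable (fun p : ℝ × (Fin n → ℝ) => (Fin.cons p.1 p.2 : Fin (n+1) → ℝ)) := by
  apply measurable_pi_lambda
  intro i
  refine Fin.cases ?_ ?_ i
  · simp; fun_prop
  · intro j; simp; fun_prop

lemma aux_pl (n : ℕ) : ∀ {f g h : (Fin n → ℝ) → ℝ≥0∞}, Measurable f → Measurable g →
    Measurable h → (∀ x y, f x * g y ≤ h ((1/2 : ℝ) • (x + y)) ^ 2) →
    (∫⁻ x, f x) * (∫⁻ x, g x) ≤ (∫⁻ x, h x) ^ 2 := by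
  induction n with
  | zero =>
    intro f g h hf hg hh H
    have : ∀ F : (Fin 0 → ℝ) → ℝ≥0∞, ∫⁻ x, F x = F 0 := by
      intro F
      rw [volume_pi, Measure.pi_of_empty _ 0, lintegral_dirac]
    rw [this, this, this]
    simpa using H 0 0
  | succ n ih =>
    intro f g h hf hg hh H
    have hc := aux_cons_meas n
    rw [aux_fubini n hf, aux_fubini n hg, aux_fubini n hh]
    have hm : ∀ F : (Fin (n+1) → ℝ) → ℝ≥0∞, Measurable F →
        Measurable fun t : ℝ => ∫⁻ x : Fin n → ℝ, F (Fin.cons t x) := fun F hF =>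
      (hF.comp hc).lintegral_prod_right'
    apply aux_pl1 (hm f hf) (hm g hg) (hm h hh)
    intro s t
    have hs : ∀ s : ℝ, Measurable (fun x : Fin n → ℝ => (Fin.cons s x : Fin (n+1) → ℝ)) :=
      fun s => hc.comp (measurable_const.prodMk measurable_id)
    apply ih (hf.comp (hs _)) (hg.comp (hs _)) (hh.comp (hs _))
    intro x y
    have e : (Fin.cons ((1/2 : ℝ) • (s + t)) ((1/2 : ℝ) • (x + y)) : Fin (n+1) → ℝ) =
        (1/2 : ℝ) • ((Fin.cons s x : Fin (n+1) → ℝ) + (Fin.cons t y : Fin (n+1) → ℝ)) := by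
      ext i
      refine Fin.cases ?_ ?_ i <;> simp [mul_add]
    have := H (Fin.cons s x) (Fin.cons t y)
    rw [← e] at this
    exact this

lemma aux_midconv {F : Type*} [NormedAddCommGroup F] [NormedSpace ℝ F] {S : Set F}
    (hS : IsClosed S) (hm : ∀ x ∈ S, ∀ y ∈ S, (1/2 : ℝ) • (x + y) ∈ S) : Convex ℝ S := by
  rw [convex_iff_forall_pos]
  intro x hx y hy a b ha hb hab
  set γ : ℝ → F := fun t => (1 - t) • x + t • y with hγ
  have hγc : Continuous γ := by fun_prop
  set T := γ ⁻¹' S with hT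
  have hTc : IsClosed T := hS.preimage hγc
  have hTm : ∀ s ∈ T, ∀ t ∈ T, (s + t) / 2 ∈ T := by
    intro s hs t ht
    have := hm _ hs _ ht
    have e : γ ((s + t) / 2) = (1/2 : ℝ) • (γ s + γ t) := by
      simp only [hγ]; module
    show γ _ ∈ S
    rwa [e]
  have h0 : (0:ℝ) ∈ T := by show γ 0 ∈ S; simpa [hγ] using hx
  have h1 : (1:ℝ) ∈ T := by show γ 1 ∈ S; simpa [hγ] using hy
  suffices b ∈ T by
    have h2 : γ b ∈ S := this
    have : a = 1 - b := by linarith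
    rw [this]; exact h2
  by_contra hbT
  obtain ⟨s, ⟨hsT, hs⟩, hsmax⟩ := ((isCompact_Icc (a := (0:ℝ)) (b := b)).inter_left hTc).exists_isGreatest
    ⟨0, h0, by simp [hb.le]⟩
  obtain ⟨t, ⟨htT, ht⟩, htmin⟩ := ((isCompact_Icc (a := b) (b := (1:ℝ))).inter_left hTc).exists_isLeast
    ⟨1, h1, by simp; linarith⟩
  have hsb : s < b := lt_of_le_of_ne hs.2 (fun h => hbT (h ▸ hsT))
  have htb : b < t := lt_of_le_of_ne ht.1 (fun h => hbT (h ▸ htT))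
  have hmid := hTm s hsT t htT
  have hs0 := hs.1
  have ht1 := ht.2
  rcases le_total ((s + t) / 2) b with h | h
  · have := hsmax ⟨hmid, by constructor <;> linarith⟩
    linarith
  · have := htmin ⟨hmid, by constructor <;> linarith⟩
    linarith

noncomputable def covG {d : ℕ} (K : Set (Fin d → ℝ)) (x : Fin d → ℝ) : ℝ≥0∞ :=
  volume (K ∩ {y | x - y ∈ K})

section
variable {d : ℕ} {K : Set (Fin d → ℝ)}

lemma covG_eq (hK : MeasurableSet K) (x : Fin d → ℝ) :
    covG K x = ∫⁻ y, K.indicator 1 y * K.indicator 1 (x - y) := by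
  have h2 : MeasurableSet {y | x - y ∈ K} := hK.preimage (by fun_prop)
  rw [covG, ← lintegral_indicator_one (hK.inter h2)]
  congr 1; ext y
  rw [Set.inter_indicator_one]
  rfl

lemma covG_le (x : Fin d → ℝ) : covG K x ≤ volume K := measure_mono inter_subset_left

lemma covG_mid (hK : MeasurableSet K) (hc : Convex ℝ K) (x y : Fin d → ℝ) :
    covG K x * covG K y ≤ covG K ((1/2 : ℝ) • (x + y)) ^ 2 := by
  have hm : ∀ x : Fin d → ℝ, MeasurableSet (K ∩ {y | x - y ∈ K}) := fun x =>
    hK.inter (hK.preimage (by fun_prop))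
  unfold covG
  rw [← lintegral_indicator_one (hm _), ← lintegral_indicator_one (hm _),
    ← lintegral_indicator_one (hm _)]
  apply aux_pl d
  · exact measurable_one.indicator (hm _)
  · exact measurable_one.indicator (hm _)
  · exact measurable_one.indicator (hm _)
  intro u v
  by_cases hu : u ∈ K ∩ {z | x - z ∈ K}
  · by_cases hv : v ∈ K ∩ {z | y - z ∈ K}
    · have : (1/2 : ℝ) • (u + v) ∈ K ∩ {z | (1/2 : ℝ) • (x + y) - z ∈ K} := by
        constructor
        · rw [smul_add]; exact hc hu.1 hv.1 (by norm_num) (by norm_num) (by norm_num)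
        · have := hc hu.2 hv.2 (a := 1/2) (b := 1/2) (by norm_num) (by norm_num) (by norm_num)
          have e : (1/2 : ℝ) • (x + y) - (1/2 : ℝ) • (u + v) = (1/2 : ℝ) • (x - u) + (1/2 : ℝ) • (y - v) := by
            module
          show _ - _ ∈ K
          rw [e]; exact this
      rw [indicator_of_mem hu, indicator_of_mem hv, indicator_of_mem this]; simp
    · rw [indicator_of_notMem hv]; simp
  · rw [indicator_of_notMem hu]; simp

lemma covG_meas (hK : MeasurableSet K) : Measurable (covG K) := by
  have : covG K = fun x => ∫⁻ y, K.indicator 1 y * K.indicator 1 (x - y) := by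
    ext x; exact covG_eq hK x
  rw [this]
  have h1 : Measurable (K.indicator (1 : (Fin d → ℝ) → ℝ≥0∞)) := measurable_one.indicator hK
  apply Measurable.lintegral_prod_right' (f := fun p : (Fin d → ℝ) × (Fin d → ℝ) => K.indicator 1 p.2 * K.indicator 1 (p.1 - p.2))
  fun_prop

lemma covG_lintegral (hK : MeasurableSet K) {φ : (Fin d → ℝ) → ℝ≥0∞} (hφ : Measurable φ) :
    ∫⁻ p, φ (p.1 + p.2) ∂((volume.restrict K).prod (volume.restrict K)) = ∫⁻ x, φ x * covG K x := by
  have h1 : Measurable (K.indicator (1 : (Fin d → ℝ) → ℝ≥0∞)) := measurable_one.indicator hK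
  rw [lintegral_prod _ (by fun_prop)]
  simp_rw [covG_eq hK]
  have e1 : ∀ x : Fin d → ℝ, φ x * ∫⁻ y, K.indicator 1 y * K.indicator 1 (x - y) = 
      ∫⁻ y, φ x * (K.indicator 1 y * K.indicator 1 (x - y)) := by
    intro x
    rw [lintegral_const_mul]
    fun_prop
  simp_rw [e1]
  conv_rhs => rw [lintegral_lintegral_swap (by fun_prop)]
  rw [← lintegral_indicator hK]
  congr 1; ext y
  rw [← lintegral_add_left_eq_self (fun x => φ x * (K.indicator 1 y * K.indicator 1 (x - y))) y]
  by_cases hy : y ∈ K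
  · simp only [indicator_of_mem hy, add_sub_cancel_left]
    rw [← lintegral_indicator hK]
    congr 1; ext z
    by_cases hz : z ∈ K <;> simp [hz]
  · simp [hy]

lemma covG_cont (hK : IsCompact K) (hc : Convex ℝ K) :
    Continuous (fun x => (covG K x).toReal) := by
  have hKm := hK.measurableSet
  have h1 : Measurable (K.indicator (1 : (Fin d → ℝ) → ℝ)) := measurable_one.indicator hKm
  have e : (fun x => (covG K x).toReal) = 
      fun x => ∫ y, K.indicator (1 : (Fin d → ℝ) → ℝ) y * K.indicator 1 (x - y) := by
    ext x
    have h2 : MeasurableSet {y | x - y ∈ K} := hKm.preimage (by fun_prop)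
    have := integral_indicator_one (μ := (volume : Measure (Fin d → ℝ))) (hKm.inter h2)
    rw [covG, ← Measure.real, ← this]
    congr 1; ext y
    rw [Set.inter_indicator_one]
    rfl
  rw [e, continuous_iff_continuousAt]
  intro x
  apply continuousAt_of_dominated (bound := K.indicator 1)
  · refine Filter.Eventually.of_forall fun z => ?_
    apply Measurable.aestronglyMeasurable
    fun_prop
  · refine Filter.Eventually.of_forall fun z => Filter.Eventually.of_forall fun y => ?_
    by_cases hy : y ∈ K <;> by_cases hz : z - y ∈ K <;> simp [hy, hz]
  · exact (integrable_indicator_iff hKm).2 (integrableOn_const hK.measure_lt_top.ne)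
  · have h0 : volume (frontier K) = 0 := hc.addHaar_frontier volume
    have h3 : ∀ᵐ y, x - y ∉ frontier K := by
      have := (Measure.measurePreserving_sub_left (volume : Measure (Fin d → ℝ)) x).quasiMeasurePreserving.ae (p := fun y => y ∉ frontier K)
        (measure_eq_zero_iff_ae_notMem.1 h0)
      exact this
    filter_upwards [h3] with y hy
    apply ContinuousAt.mul continuousAt_const
    have h4 : ContinuousAt (K.indicator (1 : (Fin d → ℝ) → ℝ)) (x - y) := by
      rcases (mem_compl hy) with _
      by_cases hi : x - y ∈ interior K
      · have : K.indicator (1 : (Fin d → ℝ) → ℝ) =ᶠ[nhds (x - y)] fun _ => 1 := by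
          filter_upwards [isOpen_interior.mem_nhds hi] with z hz
          simp [interior_subset hz]
        exact continuousAt_const.congr this.symm
      · have hcl : x - y ∉ K := fun h => hy ⟨subset_closure h, hi⟩
        have : K.indicator (1 : (Fin d → ℝ) → ℝ) =ᶠ[nhds (x - y)] fun _ => 0 := by
          filter_upwards [hK.isClosed.isOpen_compl.mem_nhds hcl] with z hz
          exact indicator_of_notMem hz _
        exact continuousAt_const.congr this.symm
    exact ContinuousAt.comp (f := fun z => z - y) h4 (by fun_prop)

end

lemma covG_supp {d : ℕ} {K : Set (Fin d → ℝ)} (hc : Convex ℝ K) {x : Fin d → ℝ} (hx : covG K x ≠ 0) :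
    x ∈ (2:ℝ) • K := by
  obtain ⟨y, hy, hy2⟩ := nonempty_of_measure_ne_zero hx
  refine ⟨(1/2 : ℝ) • y + (1/2 : ℝ) • (x - y), hc hy hy2 (by norm_num) (by norm_num) (by norm_num), ?_⟩
  simp only
  module

lemma milman_pajor_strict {d : ℕ} (hd : 0 < d) {K : Set (Fin d → ℝ)}
    (hK : IsCompact K) (hc : Convex ℝ K) (h0 : (0 : Fin d → ℝ) ∈ interior K)
    (hcent : (⨍ x in K, x) = (0 : Fin d → ℝ)) :
    (volume K).toReal / 2 ^ d < (covG K 0).toReal := by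
  have hKm := hK.measurableSet
  have hVtop : volume K ≠ ∞ := hK.measure_lt_top.ne
  have hV0 : volume K ≠ 0 := (Measure.measure_pos_of_mem_nhds _ (mem_interior_iff_mem_nhds.1 h0)).ne'
  have hGtop : ∀ x, covG K x ≠ ∞ := fun x => ne_top_of_le_ne_top hVtop (covG_le x)
  set V := (volume K).toReal with hV
  have hVpos : 0 < V := ENNReal.toReal_pos hV0 hVtop
  set c := V / 2 ^ d with hcdef
  have hcpos : 0 < c := by positivity
  set g : (Fin d → ℝ) → ℝ := fun x => (covG K x).toReal with hg
  have hgc : Continuous g := covG_cont hK hc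
  have hgm : Measurable g := hgc.measurable
  have hGm := covG_meas hKm
  have hg0 : ∀ x, 0 ≤ g x := fun x => ENNReal.toReal_nonneg
  have hGg : ∀ x, covG K x = ENNReal.ofReal (g x) := fun x => (ENNReal.ofReal_toReal (hGtop x)).symm
  set S : Set ((Fin d → ℝ) × ℝ) := {q | c * Real.exp q.2 ≤ g q.1} with hS
  have hScl : IsClosed S := isClosed_le (by fun_prop) (by fun_prop)
  have hSconv : Convex ℝ S := by
    apply aux_midconv hScl
    rintro ⟨x, s⟩ hx ⟨y, t⟩ hy
    have hx' : c * Real.exp s ≤ g x := hx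
    have hy' : c * Real.exp t ≤ g y := hy
    show c * Real.exp ((1/2 : ℝ) • (s + t)) ≤ g ((1/2 : ℝ) • (x + y))
    have h1 : g x * g y ≤ g ((1/2 : ℝ) • (x + y)) ^ 2 := by
      have := ENNReal.toReal_mono (ENNReal.pow_ne_top (hGtop _)) (covG_mid hKm hc x y)
      simpa only [ENNReal.toReal_mul, ENNReal.toReal_pow] using this
    have h2 : (c * Real.exp ((1/2 : ℝ) • (s + t))) ^ 2 ≤ g ((1/2 : ℝ) • (x + y)) ^ 2 := by
      refine le_trans ?_ h1
      calc (c * Real.exp ((1/2 : ℝ) • (s + t))) ^ 2 = (c * Real.exp s) * (c * Real.exp t) := by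
            rw [mul_pow, ← Real.exp_nat_mul]
            have : ((2:ℕ):ℝ) * ((1/2 : ℝ) • (s + t)) = s + t := by simp
            rw [this, Real.exp_add]; ring
        _ ≤ _ := by gcongr
    exact (pow_le_pow_iff_left₀ (by positivity) (hg0 _) two_ne_zero).1 h2
  set P : Measure (Fin d → ℝ) := (volume K)⁻¹ • volume.restrict K with hP
  have : IsProbabilityMeasure P := ⟨by
    simp [hP, ENNReal.inv_mul_cancel hV0 hVtop]⟩
  have hmean : ∫ x, x ∂P = 0 := by
    rw [average_eq'] at hcent
    simpa [hP] using hcent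
  have hint : Integrable (fun x : Fin d → ℝ => x) P := by
    apply Integrable.smul_measure _ (by simp [hV0])
    exact continuous_id.continuousOn.integrableOn_compact hK
  have hl : ∀ {φ : (Fin d → ℝ) → ℝ≥0∞}, Measurable φ →
      ∫⁻ p, φ (p.1 + p.2) ∂(P.prod P) = (volume K)⁻¹ * ((volume K)⁻¹ * ∫⁻ x, φ x * covG K x) := by
    intro φ hφ
    rw [hP, Measure.prod_smul_left, Measure.prod_smul_right, lintegral_smul_measure,
      lintegral_smul_measure, covG_lintegral hKm hφ]
    rfl
  -- positivity
  have hpos : ∀ᵐ p ∂(P.prod P), 0 < g (p.1 + p.2) := by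
    have h1 := hl (φ := {x | g x = 0}.indicator 1)
      (measurable_one.indicator (hgm (measurableSet_singleton 0)))
    have h2 : ∀ x, {x | g x = 0}.indicator (1 : (Fin d → ℝ) → ℝ≥0∞) x * covG K x = 0 := by
      intro x
      by_cases hx : g x = 0
      · simp [hGg, hx]
      · simp [hx]
    simp only [h2, lintegral_zero, mul_zero] at h1
    rw [lintegral_eq_zero_iff] at h1
    swap
    · exact (measurable_one.indicator (hgm (measurableSet_singleton 0))).comp (by fun_prop)
    filter_upwards [h1] with p hp
    refine lt_of_le_of_ne (hg0 _) fun h => ?_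
    simp [← h] at hp
  set r : (Fin d → ℝ) → ℝ := fun x => max 0 (min 1 (Real.log (g x / c) - (1 - c / g x))) with hr
  have hrm : Measurable r := by fun_prop
  have hr0 : ∀ x, 0 ≤ r x := fun x => le_max_left _ _
  have hr1 : ∀ x, r x ≤ 1 := fun x => max_le zero_le_one (min_le_left _ _)
  have hrint : Integrable (fun p : (Fin d → ℝ) × (Fin d → ℝ) => r (p.1 + p.2)) (P.prod P) := by
    apply Integrable.of_bound (C := 1)
    · exact (hrm.comp (by fun_prop)).aestronglyMeasurable
    · refine Filter.Eventually.of_forall fun p => ?_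
      rw [Real.norm_of_nonneg (hr0 _)]; exact hr1 _
  -- the inverse
  have hqm : Measurable (fun x => c / g x) := by fun_prop
  have hq : ∫⁻ p, ENNReal.ofReal (c / g (p.1 + p.2)) ∂(P.prod P) ≤ 1 := by
    rw [hl (φ := fun x => ENNReal.ofReal (c / g x)) (by fun_prop)]
    have h1 : ∫⁻ x, ENNReal.ofReal (c / g x) * covG K x ≤ ENNReal.ofReal c * volume ((2:ℝ) • K) := by
      rw [← lintegral_indicator_const (hK.smul (2:ℝ)).measurableSet]
      apply lintegral_mono
      intro x
      by_cases hx : covG K x = 0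
      · simp [hx]
      · simp only
        rw [indicator_of_mem (covG_supp hc hx), hGg, ← ENNReal.ofReal_mul (div_nonneg hcpos.le (hg0 _))]
        have : g x ≠ 0 := fun h => hx (by rw [hGg, h]; simp)
        rw [div_mul_cancel₀ _ this]
    have h2 : ENNReal.ofReal c * volume ((2:ℝ) • K) = volume K * volume K := by
      rw [Measure.addHaar_smul]
      have : volume K = ENNReal.ofReal V := (ENNReal.ofReal_toReal hVtop).symm
      rw [this, ← ENNReal.ofReal_mul (by positivity), ← ENNReal.ofReal_mul (by positivity),
        ← ENNReal.ofReal_mul (by positivity)]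
      congr 1
      simp [hcdef]
      field_simp
    calc _ ≤ (volume K)⁻¹ * ((volume K)⁻¹ * (volume K * volume K)) := by
          rw [← h2]; gcongr
      _ = 1 := by
          rw [← mul_assoc (volume K)⁻¹ (volume K), ENNReal.inv_mul_cancel hV0 hVtop, one_mul,
            ENNReal.inv_mul_cancel hV0 hVtop]
  have hqm' : Measurable (fun p : (Fin d → ℝ) × (Fin d → ℝ) => c / g (p.1 + p.2)) :=
    hqm.comp (by fun_prop)
  have hq0 : ∀ p : (Fin d → ℝ) × (Fin d → ℝ), 0 ≤ c / g (p.1 + p.2) := fun p =>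
    div_nonneg hcpos.le (hg0 _)
  have hqint : Integrable (fun p : (Fin d → ℝ) × (Fin d → ℝ) => c / g (p.1 + p.2)) (P.prod P) := by
    refine ⟨hqm'.aestronglyMeasurable, ?_⟩
    rw [hasFiniteIntegral_iff_ofReal (Filter.Eventually.of_forall hq0)]
    exact hq.trans_lt (by simp)
  have hqle : ∫ p, c / g (p.1 + p.2) ∂(P.prod P) ≤ 1 := by
    rw [integral_eq_lintegral_of_nonneg_ae (Filter.Eventually.of_forall hq0)
      hqm'.aestronglyMeasurable]
    exact ENNReal.toReal_le_of_le_ofReal zero_le_one (by simpa using hq)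
  -- strictness
  have hlog : ∀ x, 0 < g x → 1 - c / g x ≤ Real.log (g x / c) := by
    intro x hx
    have := Real.one_sub_inv_le_log_of_pos (div_pos hx hcpos)
    rwa [inv_div] at this
  have hlog' : ∀ x, 0 < g x → g x < c → 0 < r x := by
    intro x hx hxc
    apply lt_max_of_lt_right
    apply lt_min zero_lt_one
    have h1 : c / g x ≠ 1 := by
      rw [Ne, div_eq_one_iff_eq hx.ne']; exact hxc.ne'
    have := Real.log_lt_sub_one_of_pos (div_pos hcpos hx) h1
    have h2 : Real.log (g x / c) = - Real.log (c / g x) := by rw [← Real.log_inv, inv_div]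
    rw [h2]; linarith
  have hrpos : 0 < ∫ p, r (p.1 + p.2) ∂(P.prod P) := by
    refine lt_of_le_of_ne (integral_nonneg fun p => hr0 _) fun h => ?_
    have h1 := (integral_eq_zero_iff_of_nonneg (fun p => hr0 _) hrint).1 h.symm
    have h2 := hl (φ := fun x => ENNReal.ofReal (r x)) (by fun_prop)
    have h3 : ∫⁻ p, ENNReal.ofReal (r (p.1 + p.2)) ∂(P.prod P) = 0 := by
      rw [lintegral_eq_zero_iff (by fun_prop)]
      filter_upwards [h1] with p hp
      simp only [Pi.zero_apply] at hp
      simp [hp]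
    rw [h3] at h2
    have h4 : ∫⁻ x, ENNReal.ofReal (r x) * covG K x = 0 := by
      simpa [hVtop] using h2.symm
    rw [lintegral_eq_zero_iff (by fun_prop)] at h4
    have hU : IsOpen {x | 0 < g x ∧ g x < c} :=
      (isOpen_lt continuous_const hgc).inter (isOpen_lt hgc continuous_const)
    have hU0 : volume {x | 0 < g x ∧ g x < c} = 0 := by
      rw [measure_eq_zero_iff_ae_notMem]
      filter_upwards [h4] with x hx hxU
      have := hlog' x hxU.1 hxU.2
      simp only [Pi.zero_apply, mul_eq_zero, ENNReal.ofReal_eq_zero] at hx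
      rcases hx with hx | hx
      · linarith
      · have h5 := hxU.1
        simp [hg, hx] at h5
    have hUe := (hU.measure_eq_zero_iff volume).1 hU0
    have : Nonempty (Fin d) := ⟨⟨0, hd⟩⟩
    obtain ⟨z, hz⟩ := (ne_univ_iff_exists_notMem _).1 (hK.smul (2:ℝ)).ne_univ
    have hgz : g z = 0 := by
      by_contra hne
      refine hz (covG_supp hc fun h => hne ?_)
      simp [hg, h]
    have hg00 : 0 < g 0 := by
      apply ENNReal.toReal_pos _ (hGtop 0)
      refine (Measure.measure_pos_of_mem_nhds (x := 0) _ ?_).ne'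
      · apply Filter.inter_mem (mem_interior_iff_mem_nhds.1 h0)
        have : Continuous (fun y : Fin d → ℝ => 0 - y) := by fun_prop
        apply this.continuousAt.preimage_mem_nhds
        simpa using (mem_interior_iff_mem_nhds.1 h0)
    have hmin : 0 < min (g 0) c := lt_min hg00 hcpos
    obtain ⟨w, hw⟩ := intermediate_value_univ z 0 hgc (show min (g 0) c / 2 ∈ Icc (g z) (g 0) by
      rw [hgz]
      constructor
      · positivity
      · have := min_le_left (g 0) c
        linarith)
    have : w ∈ {x | 0 < g x ∧ g x < c} := by
      have h6 := min_le_right (g 0) c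
      constructor
      · rw [hw]; positivity
      · rw [hw]; linarith
    rw [hUe] at this
    exact this
  -- Jensen
  have hψint : Integrable (fun p : (Fin d → ℝ) × (Fin d → ℝ) =>
      1 - c / g (p.1 + p.2) + r (p.1 + p.2)) (P.prod P) :=
    ((integrable_const 1).sub hqint).add hrint
  have haddint : Integrable (fun p : (Fin d → ℝ) × (Fin d → ℝ) => p.1 + p.2) (P.prod P) :=
    (hint.comp_fst P).add (hint.comp_snd P)
  have hmem := hSconv.integral_mem (μ := P.prod P) hScl
    (f := fun p => (p.1 + p.2, 1 - c / g (p.1 + p.2) + r (p.1 + p.2))) (by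
      filter_upwards [hpos] with p hp
      set x := p.1 + p.2
      show c * Real.exp (1 - c / g x + r x) ≤ g x
      have h1 := hlog x hp
      have h2 : r x ≤ Real.log (g x / c) - (1 - c / g x) :=
        max_le (by linarith) (min_le_right _ _)
      calc c * Real.exp (1 - c / g x + r x) ≤ c * Real.exp (Real.log (g x / c)) := by
            gcongr; linarith
        _ = g x := by rw [Real.exp_log (div_pos hp hcpos)]; field_simp) (haddint.prodMk hψint)
  have e1 : ∫ p : (Fin d → ℝ) × (Fin d → ℝ), p.1 + p.2 ∂(P.prod P) = 0 := by
    rw [integral_add (hint.comp_fst P) (hint.comp_snd P), integral_fun_fst (fun x => x),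
      integral_fun_snd (fun x => x), hmean]
    simp
  have e2 : 0 < ∫ p : (Fin d → ℝ) × (Fin d → ℝ), 1 - c / g (p.1 + p.2) + r (p.1 + p.2) ∂(P.prod P) := by
    have h7 : Integrable (fun p : (Fin d → ℝ) × (Fin d → ℝ) => 1 - c / g (p.1 + p.2)) (P.prod P) :=
      (integrable_const 1).sub hqint
    rw [integral_add h7 hrint, integral_sub (integrable_const 1) hqint]
    simp only [integral_const, probReal_univ, smul_eq_mul, one_mul]
    linarith
  rw [integral_pair haddint hψint, e1] at hmem
  have hfin : c * Real.exp _ ≤ g 0 := hmem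
  refine lt_of_lt_of_le ?_ hfin
  have := Real.one_lt_exp_iff.2 e2
  nlinarith

/-- If `K ⊆ ℝ^d` (`d ≥ 1`) is a convex body with centroid at the origin whose only
interior lattice point is the origin, then `#(K ∩ ℤ^d) < 6^d`. -/
theorem lattice_point_bound_centroid_interior (d : ℕ) (hd : 0 < d) (K : Set (Fin d → ℝ))
    (hKcpt : IsCompact K) (hKconv : Convex ℝ K) (hKint : (interior K).Nonempty)
    (hcent : (⨍ x in K, x) = (0 : Fin d → ℝ))
    (honly : interior K ∩ latticePts d = {0}) :
    Set.ncard (K ∩ latticePts d) < 6 ^ d := by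
  have h0 : (0 : Fin d → ℝ) ∈ interior K := by
    have : (0 : Fin d → ℝ) ∈ interior K ∩ latticePts d := by rw [honly]; rfl
    exact this.1
  by_cases hfin : (K ∩ latticePts d).Finite
  swap
  · rw [Set.Infinite.ncard hfin]; positivity
  have hmp := milman_pajor_strict hd hKcpt hKconv h0 hcent
  have hVtop : volume K ≠ ∞ := hKcpt.measure_lt_top.ne
  have hV0 : volume K ≠ 0 := (Measure.measure_pos_of_mem_nhds _ (mem_interior_iff_mem_nhds.1 h0)).ne'
  have hVpos := ENNReal.toReal_pos hV0 hVtop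
  set D : Set (Fin d → ℝ) := interior K ∩ {y | 0 - y ∈ interior K} with hD
  have hDo : IsOpen D := isOpen_interior.inter (isOpen_interior.preimage (by fun_prop))
  have hintc : Convex ℝ (interior K) := hKconv.interior
  have hDvol : volume D = covG K 0 := by
    have h1 : interior K =ᵐ[volume] K := interior_ae_eq_of_null_frontier (hKconv.addHaar_frontier volume)
    have h2 : {y : Fin d → ℝ | 0 - y ∈ interior K} =ᵐ[volume] {y | 0 - y ∈ K} :=
      (Measure.measurePreserving_sub_left (volume : Measure (Fin d → ℝ)) 0).quasiMeasurePreserving.preimage_ae_eq h1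
    exact measure_congr (h1.inter h2)
  set T := hfin.toFinset with hT
  have hTmem : ∀ x, x ∈ T ↔ x ∈ K ∧ x ∈ latticePts d := fun x => by simp [hT]
  rw [ncard_eq_toFinset_card _ hfin]
  set B : (Fin d → ℝ) → Set (Fin d → ℝ) := fun x => x +ᵥ ((1/2 : ℝ) • D) with hB
  have hBvol : ∀ x, volume (B x) = ENNReal.ofReal ((1/2)^d) * covG K 0 := by
    intro x
    rw [hB, measure_vadd, Measure.addHaar_smul, hDvol]
    simp
  have hBm : ∀ x, MeasurableSet (B x) := fun x =>
    ((hDo.smul₀ (by norm_num : (1/2 : ℝ) ≠ 0)).vadd x).measurableSet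
  have hdisj : (T : Set (Fin d → ℝ)).PairwiseDisjoint B := by
    intro x hx y hy hxy
    rw [Function.onFun, Set.disjoint_left]
    rintro _ ⟨_, ⟨a, ha, rfl⟩, rfl⟩ ⟨_, ⟨b, hb, hab⟩, hxyab⟩
    apply hxy
    simp only [vadd_eq_add] at hxyab hab
    subst hab
    have e : x - y = (1/2 : ℝ) • b + (1/2 : ℝ) • (0 - a) := by
      have : x - y = (1/2 : ℝ) • b - (1/2 : ℝ) • a := by
        rw [sub_eq_sub_iff_add_eq_add, ← hxyab]; abel
      rw [this]; module
    have hmem : x - y ∈ interior K := by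
      rw [e]; exact hintc hb.1 ha.2 (by norm_num) (by norm_num) (by norm_num)
    have hlat : x - y ∈ latticePts d := by
      intro i
      obtain ⟨m, hm⟩ := ((hTmem x).1 hx).2 i
      obtain ⟨n, hn⟩ := ((hTmem y).1 hy).2 i
      exact ⟨m - n, by simp [hm, hn]⟩
    have : x - y ∈ interior K ∩ latticePts d := ⟨hmem, hlat⟩
    rw [honly] at this
    exact sub_eq_zero.1 this
  have hsub : (⋃ x ∈ T, B x) ⊆ (3/2 : ℝ) • K := by
    intro z hz
    simp only [mem_iUnion] at hz
    obtain ⟨x, hx, _, ⟨a, ha, rfl⟩, rfl⟩ := hz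
    refine ⟨(2/3 : ℝ) • x + (1/3 : ℝ) • a, hKconv ((hTmem x).1 hx).1 (interior_subset ha.1)
      (by norm_num) (by norm_num) (by norm_num), ?_⟩
    simp only [vadd_eq_add]
    module
  have hle : (T.card : ℝ≥0∞) * (ENNReal.ofReal ((1/2)^d) * covG K 0) ≤
      ENNReal.ofReal ((3/2)^d) * volume K := by
    calc _ = ∑ x ∈ T, volume (B x) := by simp [hBvol]
      _ = volume (⋃ x ∈ T, B x) := (measure_biUnion_finset hdisj fun x _ => hBm x).symm
      _ ≤ volume ((3/2 : ℝ) • K) := measure_mono hsub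
      _ = _ := by
        rw [Measure.addHaar_smul, abs_of_nonneg (by positivity)]
        simp
  have hle' : (T.card : ℝ) * ((1/2)^d * (covG K 0).toReal) ≤ (3/2)^d * (volume K).toReal := by
    have := ENNReal.toReal_mono (ENNReal.mul_ne_top ENNReal.ofReal_ne_top hVtop) hle
    rw [ENNReal.toReal_mul, ENNReal.toReal_mul, ENNReal.toReal_mul,
      ENNReal.toReal_ofReal (by positivity), ENNReal.toReal_ofReal (by positivity)] at this
    simpa using this
  set V := (volume K).toReal
  set g := (covG K 0).toReal
  have hp : (0:ℝ) < 2 ^ d := by positivity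
  have h1 : (T.card : ℝ) * g ≤ 3 ^ d * V := by
    rw [div_pow, div_pow, one_pow] at hle'
    field_simp at hle'
    linarith
  have h2 : V < g * 2 ^ d := (div_lt_iff₀ hp).1 hmp
  have hg : 0 < g := lt_trans (by positivity) hmp
  have h3 : (T.card : ℝ) * g < 6 ^ d * g := by
    calc _ ≤ 3 ^ d * V := h1
      _ < 3 ^ d * (g * 2 ^ d) := by gcongr
      _ = 6 ^ d * g := by
        rw [show (6:ℝ) = 3 * 2 by norm_num, mul_pow]; ring
  have h4 := lt_of_mul_lt_mul_right h3 hg.le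
  exact_mod_cast h4
end

section
/- Let S be a d-dimensional simplex in ℝ^d with centroid at the origin such that λ₁(S)⁻¹ is a positive integer. If #(S ∩ ℤ^d) = C(d + λ₁(S)⁻¹·(d+1), d), then S is unimodularly equivalent to λ₁(S)⁻¹·S_d, where S_d = {x ∈ ℝ^d : x_i ≥ −1 for 1 ≤ i ≤ d, and x_1 + ⋯ + x_d ≤ 1} is the simplex (d+1)·conv{0, e_1, …, e_d} − 𝟙. -/
open MeasureTheory Set Pointwise

/-- The simplex `S_d = {x ∈ ℝ^d : x_i ≥ -1 for all i, x_1 + ⋯ + x_d ≤ 1}`. -/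
def ehrhartSimplex (d : ℕ) : Set (Fin d → ℝ) :=
  {x | (∀ i, -1 ≤ x i) ∧ ∑ i, x i ≤ 1}

lemma aux_centroid {d : ℕ} (b : AffineBasis (Fin (d+1)) ℝ (Fin d → ℝ))
    (hcent : (⨍ x in convexHull ℝ (Set.range b), x) = (0 : Fin d → ℝ)) (i j : Fin (d+1)) :
    b.coord i 0 = b.coord j 0 := by
  classical
  rcases eq_or_ne i j with rfl | hij
  · rfl
  set S := convexHull ℝ (Set.range b) with hSdef
  have hSc : IsCompact S := (Set.finite_range b).isCompact_convexHull ℝ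
  have hSm : MeasurableSet S := hSc.isClosed.measurableSet
  have hint : (interior S).Nonempty :=
    interior_convexHull_nonempty_iff_affineSpan_eq_top.2 b.tot
  have hpos : 0 < volume S := MeasureTheory.Measure.measure_pos_of_nonempty_interior _ hint
  have hfin : volume S ≠ ⊤ := hSc.measure_lt_top.ne
  have hreal : 0 < volume.real S := ENNReal.toReal_pos hpos.ne' hfin
  have hI : ∫ x in S, x = 0 := by
    rw [setAverage_eq, smul_eq_zero] at hcent
    rcases hcent with h | h
    · exact absurd h (inv_pos.2 hreal).ne'
    · exact h
  let w := b j - b i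
  let φ : (Fin d → ℝ) →ₗ[ℝ] ℝ := (b.coord i).linear - (b.coord j).linear
  have hlin : ∀ k x, b.coord k x = (b.coord k).linear x + b.coord k 0 := by
    intro k x
    have := (b.coord k).map_vadd 0 x
    simpa using this
  let T' : (Fin d → ℝ) →L[ℝ] (Fin d → ℝ) :=
    LinearMap.toContinuousLinearMap (LinearMap.id + φ.smulRight w)
  let c : Fin d → ℝ := (b.coord i 0 - b.coord j 0) • w
  have hT'a : ∀ x, T' x = x + φ x • w := fun x => by simp [T']
  let T : (Fin d → ℝ) → (Fin d → ℝ) := fun x => T' x + c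
  have hT : ∀ x, T x = x + (b.coord i x - b.coord j x) • w := by
    intro x
    simp only [T, hT'a, c, hlin i x, hlin j x, φ, LinearMap.sub_apply]
    module
  have hcw : ∀ k, (b.coord k).linear w = (if k = j then 1 else 0) - (if k = i then 1 else 0) := by
    intro k
    have := (b.coord k).linearMap_vsub (b j) (b i)
    simp only [vsub_eq_sub] at this
    rw [this, b.coord_apply, b.coord_apply]
  have hcT : ∀ k x, b.coord k (T x) = b.coord k x + (b.coord i x - b.coord j x) *
      ((if k = j then 1 else 0) - (if k = i then 1 else 0)) := by
    intro k x
    rw [hT, hlin k, map_add, map_smul, hcw, smul_eq_mul, hlin k x]; ring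
  have hTT : ∀ x, T (T x) = x := by
    intro x
    rw [hT (T x), hcT, hcT, hT x]
    simp only [hij, hij.symm, if_true, if_false]
    module
  have hTS : ∀ x ∈ S, T x ∈ S := by
    intro x hx
    rw [hSdef, b.convexHull_eq_nonneg_coord] at hx ⊢
    intro k
    have h1 := hx k
    have h2 := hx i
    have h3 := hx j
    rw [hcT]
    by_cases hkj : k = j
    · subst hkj
      simp [hij.symm]; linarith
    · by_cases hki : k = i
      · subst hki; simp [hij]; linarith
      · simpa [hkj, hki] using h1
  have himg : T '' S = S := by
    ext x; constructor
    · rintro ⟨y, hy, rfl⟩; exact hTS y hy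
    · intro hx; exact ⟨T x, hTS x hx, hTT x⟩
  have hinj : InjOn T S := fun x _ y _ h => by rw [← hTT x, h, hTT]
  have hder : ∀ x ∈ S, HasFDerivWithinAt T T' S x := fun x _ =>
    (T'.hasFDerivAt.add_const c).hasFDerivWithinAt
  have e1 := integral_image_eq_integral_abs_det_fderiv_smul volume hSm hder hinj (fun _ => (1:ℝ))
  have e2 := integral_image_eq_integral_abs_det_fderiv_smul volume hSm hder hinj (fun x => x)
  rw [himg] at e1 e2
  have hdet : |T'.det| ≠ 0 := by
    intro h
    rw [h] at e1
    simp at e1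
    exact hreal.ne' e1
  have hii : IntegrableOn (fun x : Fin d → ℝ => x) S := continuous_id.continuousOn.integrableOn_compact hSc
  rw [integral_smul, hI] at e2
  have e3 : ∫ x in S, T x = 0 := (smul_eq_zero.1 e2.symm).resolve_left hdet
  have hiT : IntegrableOn (fun x : Fin d → ℝ => T' x) S :=
    T'.continuous.continuousOn.integrableOn_compact hSc
  have e4 : ∫ x in S, T x = volume.real S • c := by
    simp only [T]
    rw [integral_add hiT (by simp [hfin, integrable_const_iff, isFiniteMeasure_restrict]), ContinuousLinearMap.integral_comp_comm T' hii, hI]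
    simp
  rw [e4] at e3
  have hc : c = 0 := (smul_eq_zero.1 e3).resolve_left hreal.ne'
  have hw : w ≠ 0 := by
    intro h
    exact hij (b.ind.injective (sub_eq_zero.1 h)).symm
  exact sub_eq_zero.1 ((smul_eq_zero.1 hc).resolve_right hw)

lemma aux_surj {d N : ℕ} (A : Set (Fin d → ℤ)) (F : (Fin d → ℤ) → (Fin d → ℕ))
    (hF : Set.InjOn F A) (hs : ∀ z ∈ A, ∑ i, F z i ≤ N)
    (hA : A.ncard = (d + N).choose d) (f : Fin d → ℕ) (hf : ∑ i, f i ≤ N) :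
    ∃ z ∈ A, F z = f := by
  classical
  have hfin : A.Finite := Set.finite_of_ncard_pos (by
    rw [hA]; exact Nat.choose_pos (by omega))
  let G : (Fin d → ℕ) → (Fin (d+1) →₀ ℕ) := fun g =>
    Finsupp.equivFunOnFinite.symm (Fin.cons (N - ∑ i, g i) g)
  have hG : Function.Injective G := by
    intro g h hgh
    have := Finsupp.equivFunOnFinite.symm.injective hgh
    exact (Fin.cons_inj.1 this).2
  have hGm : ∀ g : Fin d → ℕ, ∑ i, g i ≤ N → G g ∈ Finset.finsuppAntidiag Finset.univ N := by
    intro g hg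
    rw [Finset.mem_finsuppAntidiag]
    refine ⟨?_, by simp⟩
    simp [G, Fin.sum_univ_succ]
    omega
  have := Finset.surjOn_of_injOn_of_card_le (s := hfin.toFinset)
    (t := Finset.finsuppAntidiag (Finset.univ : Finset (Fin (d+1))) N) (fun z => G (F z))
    (fun z hz => hGm _ (hs z (by simpa using hz)))
    (fun x hx y hy h => hF (by simpa using hx) (by simpa using hy) (hG h))
    (by
      rw [Finset.card_finsuppAntidiag_nat_eq_choose, ← Set.ncard_eq_toFinset_card A hfin, hA]
      simp only [Finset.card_univ, Fintype.card_fin]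
      rw [show d + 1 + N - 1 = d + N by omega]
      first
        | exact le_of_eq rfl
        | exact le_of_eq (Nat.choose_symm_add).symm)
  obtain ⟨z, hz, h⟩ := this (hGm f hf)
  exact ⟨z, by simpa using hz, hG h⟩

lemma core {d n : ℕ} (hn : 0 < n) (M : (Fin d → ℝ) →ₗ[ℝ] (Fin d → ℝ)) (S : Set (Fin d → ℝ))
    (hS : S = {x | (∀ i, -(n:ℝ) ≤ M x i) ∧ ∑ i, M x i ≤ n})
    (hmin : ∀ z : Fin d → ℤ, z ≠ 0 → (∀ i, -1 < M (fun i => (z i : ℝ)) i) →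
      1 ≤ ∑ i, M (fun i => (z i : ℝ)) i)
    (hcard : Set.ncard (S ∩ latticePts d) = (d + n * (d + 1)).choose d) :
    ∃ U : Matrix (Fin d) (Fin d) ℤ, U.det.natAbs = 1 ∧ ∃ z : Fin d → ℤ,
      S = (fun x => (U.map ((↑) : ℤ → ℝ)).mulVec x + fun i => (z i : ℝ)) ''
        ((n : ℝ) • ehrhartSimplex d) := by
  classical
  let C : (Fin d → ℤ) → (Fin d → ℝ) := fun z i => (z i : ℝ)
  have hCinj : Function.Injective C := fun x y h => by
    ext i; have := congrFun h i; simpa [C] using this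
  have hCsub : ∀ x y, C (x - y) = C x - C y := fun x y => by ext i; simp [C]
  have hCneg : ∀ x, C (-x) = - C x := fun x => by ext i; simp [C]
  have hminC : ∀ z : Fin d → ℤ, z ≠ 0 → (∀ i, -1 < M (C z) i) → 1 ≤ ∑ i, M (C z) i := hmin
  let A : Set (Fin d → ℤ) := {z | C z ∈ S}
  have hAC : S ∩ latticePts d = C '' A := by
    ext x; constructor
    · rintro ⟨h1, h2⟩
      choose z hz using h2
      have : C z = x := by ext i; exact (hz i).symm
      exact ⟨z, by simpa [A, this] using h1, this⟩
    · rintro ⟨z, hz, rfl⟩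
      exact ⟨hz, fun i => ⟨z i, rfl⟩⟩
  rw [hAC, Set.ncard_image_of_injective _ hCinj] at hcard
  have hAmem : ∀ z ∈ A, (∀ i, -(n:ℝ) ≤ M (C z) i) ∧ ∑ i, M (C z) i ≤ n := by
    intro z hz
    have : C z ∈ S := hz
    rw [hS] at this; exact this
  let F : (Fin d → ℤ) → (Fin d → ℕ) := fun z i => (⌊M (C z) i⌋ + n).toNat
  have hFz : ∀ z ∈ A, ∀ i, ((F z i : ℕ) : ℤ) = ⌊M (C z) i⌋ + n := by
    intro z hz i
    apply Int.toNat_of_nonneg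
    have : -(n:ℤ) ≤ ⌊M (C z) i⌋ := Int.le_floor.2 (by push_cast; exact (hAmem z hz).1 i)
    omega
  have hFr : ∀ z ∈ A, ∀ i, (F z i : ℝ) - n ≤ M (C z) i ∧ M (C z) i < (F z i : ℝ) - n + 1 := by
    intro z hz i
    have h : ((F z i : ℕ) : ℝ) = ⌊M (C z) i⌋ + n := by exact_mod_cast hFz z hz i
    rw [h]
    have h1 := Int.floor_le (M (C z) i)
    have h2 := Int.lt_floor_add_one (M (C z) i)
    constructor <;> linarith
  have key : ∀ f : Fin d → ℕ, ∑ i, f i ≤ n * (d+1) → ∃ z ∈ A, F z = f := by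
    intro f hf
    refine aux_surj A F ?_ ?_ hcard f hf
    · intro x hx y hy hxy
      by_contra hne
      have h1 : ∀ i, M (C x) i - M (C y) i < 1 ∧ -1 < M (C x) i - M (C y) i := by
        intro i
        have a := hFr x hx i
        have b := hFr y hy i
        rw [hxy] at a
        constructor <;> linarith
      have a := hminC (x - y) (sub_ne_zero.2 hne) (by
        intro i; rw [hCsub, map_sub]; simpa using (h1 i).2)
      have b := hminC (y - x) (sub_ne_zero.2 (Ne.symm hne)) (by
        intro i; rw [hCsub, map_sub]
        have := (h1 i).1
        simp only [Pi.sub_apply]; linarith)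
      rw [hCsub, map_sub] at a b
      simp only [Pi.sub_apply, Finset.sum_sub_distrib] at a b
      linarith
    · intro z hz
      have h1 := (hAmem z hz).2
      have h2 : ∑ i, ((F z i : ℝ) - n) ≤ ∑ i, M (C z) i :=
        Finset.sum_le_sum fun i _ => (hFr z hz i).1
      simp only [Finset.sum_sub_distrib, Finset.sum_const, Finset.card_univ, Fintype.card_fin,
        nsmul_eq_mul] at h2
      have h3 : (∑ i, (F z i : ℝ)) ≤ n * (d + 1) := by linarith
      exact_mod_cast h3
  have unit : ∀ i, ∃ w : Fin d → ℤ, M (C w) = Pi.single i 1 := by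
    intro i
    have hNpos : 0 < n * (d+1) := by positivity
    obtain ⟨x, hxA, hx⟩ := key (Pi.single i (n * (d+1))) (by simp)
    obtain ⟨y, hyA, hy⟩ := key (Pi.single i (n * (d+1) - 1)) (by simp)
    have hx1 := hFr x hxA
    have hy1 := hFr y hyA
    have hxs := (hAmem x hxA).2
    have hys := (hAmem y hyA).2
    rw [hx] at hx1
    rw [hy] at hy1
    have hxeq : ∀ k, ((Pi.single i (n * (d+1)) : Fin d → ℕ) k : ℝ) - n = M (C x) k := by
      have hle : ∀ k ∈ Finset.univ, ((Pi.single i (n * (d+1)) : Fin d → ℕ) k : ℝ) - n ≤ M (C x) k :=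
        fun k _ => (hx1 k).1
      have hsum : ∑ k, (((Pi.single i (n * (d+1)) : Fin d → ℕ) k : ℝ) - n) = n := by
        rw [Finset.sum_sub_distrib, ← Nat.cast_sum]
        simp; ring
      have := (Finset.sum_eq_sum_iff_of_le hle).1 (le_antisymm (Finset.sum_le_sum hle) (by
        rw [hsum]; exact hxs))
      exact fun k => this k (Finset.mem_univ _)
    have hxsum : ∑ k, M (C x) k = n := by
      simp only [← hxeq]
      rw [Finset.sum_sub_distrib, ← Nat.cast_sum]
      simp; ring
    let D := x - y
    have hMD : ∀ k, M (C D) k = M (C x) k - M (C y) k := by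
      intro k; simp only [D]; rw [hCsub, map_sub]; rfl
    have hMDn : ∀ k, M (C (-D)) k = - M (C D) k := by
      intro k; rw [hCneg, map_neg]; rfl
    have hDi : 0 < M (C D) i ∧ M (C D) i ≤ 1 := by
      have a := hy1 i
      have b := hxeq i
      simp only [Pi.single_eq_same] at a b
      rw [Nat.cast_pred hNpos] at a
      rw [hMD]
      constructor <;> linarith
    have hDk : ∀ k, k ≠ i → -1 < M (C D) k ∧ M (C D) k ≤ 0 := by
      intro k hk
      have a := hy1 k
      have b := hxeq k
      simp only [Pi.single_eq_of_ne hk] at a b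
      rw [hMD]
      constructor <;> linarith
    have hD0 : D ≠ 0 := by
      intro h
      have : C (0 : Fin d → ℤ) = 0 := by ext; simp [C]
      rw [h, this, map_zero] at hDi
      exact lt_irrefl _ hDi.1
    have hDsum : 0 ≤ ∑ k, M (C D) k := by
      simp only [hMD, Finset.sum_sub_distrib]; linarith
    have hi1 : M (C D) i = 1 := by
      by_contra hne
      have hlt := lt_of_le_of_ne hDi.2 hne
      have := hminC (-D) (neg_ne_zero.2 hD0) (by
        intro k
        rw [hMDn]
        by_cases hk : k = i
        · subst hk; linarith
        · linarith [(hDk k hk).2])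
      simp only [hMDn, Finset.sum_neg_distrib] at this
      linarith
    have h1 := hminC D hD0 (by
      intro k
      by_cases hk : k = i
      · subst hk; linarith
      · exact (hDk k hk).1)
    rw [← Finset.add_sum_erase _ _ (Finset.mem_univ i), hi1] at h1
    have hle : ∀ k ∈ Finset.univ.erase i, M (C D) k ≤ 0 := fun k hk =>
      (hDk k (Finset.ne_of_mem_erase hk)).2
    have h0 := (Finset.sum_eq_zero_iff_of_nonpos hle).1
      (le_antisymm (Finset.sum_nonpos hle) (by linarith))
    refine ⟨D, ?_⟩
    ext k
    by_cases hk : k = i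
    · subst hk; simp [hi1]
    · rw [Pi.single_eq_of_ne hk]
      exact h0 k (by simp [hk])
  choose w hw using unit
  let U : Matrix (Fin d) (Fin d) ℤ := Matrix.of fun i j => w j i
  have hUC : ∀ m : Fin d → ℤ, C (U.mulVec m) = (U.map ((↑) : ℤ → ℝ)).mulVec (C m) := by
    intro m; ext i; simp [C, Matrix.mulVec, dotProduct]
  have hMU : ∀ y : Fin d → ℝ, M ((U.map ((↑) : ℤ → ℝ)).mulVec y) = y := by
    intro y
    have : (U.map ((↑) : ℤ → ℝ)).mulVec y = ∑ j, y j • C (w j) := by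
      ext i
      simp [Matrix.mulVec, dotProduct, U, C, Finset.sum_apply, mul_comm]
    rw [this, map_sum]
    simp only [map_smul, hw]
    ext k
    simp [Finset.sum_apply, Pi.single_apply]
  have hMsurj : Function.Surjective M := fun y => ⟨_, hMU y⟩
  have hMinj : Function.Injective M := LinearMap.injective_iff_surjective.2 hMsurj
  have hUM : ∀ x : Fin d → ℝ, (U.map ((↑) : ℤ → ℝ)).mulVec (M x) = x := fun x => hMinj (hMU _)
  have hint : ∀ z : Fin d → ℤ, ∃ m : Fin d → ℤ, U.mulVec m = z := by
    intro z
    refine ⟨fun i => ⌊M (C z) i⌋, ?_⟩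
    by_contra hne
    set m : Fin d → ℤ := fun i => ⌊M (C z) i⌋ with hm
    have hM : ∀ i, M (C (U.mulVec m - z)) i = ⌊M (C z) i⌋ - M (C z) i := by
      intro i; rw [hCsub, map_sub, hUC, hMU]; rfl
    have := hminC (U.mulVec m - z) (sub_ne_zero.2 hne) (by
      intro i; rw [hM]; linarith [Int.lt_floor_add_one (M (C z) i)])
    have h2 : ∑ i, M (C (U.mulVec m - z)) i ≤ 0 := Finset.sum_nonpos fun i _ => by
      rw [hM]; linarith [Int.floor_le (M (C z) i)]
    linarith
  have hdet : IsUnit U.det := by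
    have : IsUnit U := Matrix.mulVec_surjective_iff_isUnit.1 hint
    exact (Matrix.isUnit_iff_isUnit_det _).1 this
  refine ⟨U, Int.isUnit_iff_natAbs_eq.1 hdet, 0, ?_⟩
  have hn' : (0:ℝ) < n := by exact_mod_cast hn
  have hE : ∀ y : Fin d → ℝ, y ∈ (n:ℝ) • ehrhartSimplex d ↔ (∀ i, -(n:ℝ) ≤ y i) ∧ ∑ i, y i ≤ n := by
    intro y
    rw [Set.mem_smul_set_iff_inv_smul_mem₀ hn'.ne']
    simp only [ehrhartSimplex, Set.mem_ofPred_eq, Pi.smul_apply, smul_eq_mul, ← Finset.mul_sum]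
    rw [inv_mul_le_iff₀ hn', mul_one]
    refine and_congr_left fun _ => forall_congr' fun i => ?_
    rw [le_inv_mul_iff₀ hn', mul_neg_one]
  ext x
  constructor
  · intro hx
    rw [hS] at hx
    refine ⟨M x, (hE _).2 hx, ?_⟩
    simp only [hUM]; ext i; simp
  · rintro ⟨y, hy, rfl⟩
    rw [hS]
    have : ((U.map ((↑) : ℤ → ℝ)).mulVec y + fun i => (((0 : Fin d → ℤ) i : ℤ) : ℝ)) = (U.map ((↑) : ℤ → ℝ)).mulVec y := by
      ext i; simp
    simp only [this, Set.mem_ofPred_eq, hMU]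
    exact (hE y).1 hy

theorem simplex_lattice_point_bound_equality (d : ℕ) (v : Fin (d + 1) → (Fin d → ℝ))
    (hv : AffineIndependent ℝ v) (S : Set (Fin d → ℝ))
    (hS : S = convexHull ℝ (Set.range v))
    (hcent : (⨍ x in S, x) = (0 : Fin d → ℝ))
    (l1 : ℝ)
    (hl1 : IsLeast {l : ℝ | 0 < l ∧ ∃ z : Fin d → ℤ,
      (fun i => (z i : ℝ)) ≠ 0 ∧ (fun i => (z i : ℝ)) ∈ l • S} l1)
    (n : ℕ) (hn : 0 < n) (hln : l1⁻¹ = (n : ℝ))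
    (hcard : Set.ncard (S ∩ latticePts d) = (d + n * (d + 1)).choose d) :
    ∃ U : Matrix (Fin d) (Fin d) ℤ, U.det.natAbs = 1 ∧ ∃ z : Fin d → ℤ,
      S = (fun x => (U.map ((↑) : ℤ → ℝ)).mulVec x + fun i => (z i : ℝ)) ''
        ((n : ℝ) • ehrhartSimplex d) := by
  have hn' : (0:ℝ) < n := by exact_mod_cast hn
  have htop : affineSpan ℝ (Set.range v) = ⊤ := by
    rw [hv.affineSpan_eq_top_iff_card_eq_finrank_add_one]; simp
  let b : AffineBasis (Fin (d+1)) ℝ (Fin d → ℝ) := ⟨v, hv, htop⟩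
  have hSb : S = convexHull ℝ (Set.range b) := hS
  have hc := aux_centroid b (by rw [← hSb]; exact hcent)
  have hd' : (0:ℝ) < d + 1 := by positivity
  have hc0 : ∀ k, b.coord k 0 = 1 / (d + 1) := by
    intro k
    have h := b.sum_coord_apply_eq_one 0
    simp only [fun i => hc i k, Finset.sum_const, Finset.card_univ, Fintype.card_fin,
      nsmul_eq_mul] at h
    push_cast at h
    field_simp; linarith
  have hlin : ∀ k x, b.coord k x = (b.coord k).linear x + 1 / (d+1) := by
    intro k x
    have := (b.coord k).map_vadd 0 x
    simpa [hc0] using this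
  let M : (Fin d → ℝ) →ₗ[ℝ] (Fin d → ℝ) :=
    LinearMap.pi fun i => ((n : ℝ) * (d+1)) • (b.coord i.succ).linear
  have hM : ∀ x i, M x i = n * (d+1) * b.coord i.succ x - n := by
    intro x i
    simp only [M, LinearMap.pi_apply, LinearMap.smul_apply, smul_eq_mul, hlin]
    field_simp; ring
  have hMs : ∀ x, ∑ i, M x i = n - n * (d+1) * b.coord 0 x := by
    intro x
    have h := b.sum_coord_apply_eq_one x
    rw [Fin.sum_univ_succ] at h
    simp only [hM, Finset.sum_sub_distrib, ← Finset.mul_sum]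
    simp
    rw [← eq_sub_iff_add_eq'] at h
    rw [h]; ring
  have hS' : S = {x | (∀ i, -(n:ℝ) ≤ M x i) ∧ ∑ i, M x i ≤ n} := by
    rw [hSb, b.convexHull_eq_nonneg_coord]
    have hp : (0:ℝ) < n * (d+1) := by positivity
    ext x
    simp only [Set.mem_ofPred_eq, hMs]
    simp only [hM]
    rw [Fin.forall_fin_succ, and_comm]
    refine and_congr (forall_congr' fun i => ?_) ?_
    · rw [← mul_nonneg_iff_of_pos_left hp]
      constructor <;> intro h <;> linarith
    · rw [← mul_nonneg_iff_of_pos_left hp]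
      constructor <;> intro h <;> linarith
  refine core hn M S hS' ?_ hcard
  intro z hz h1
  by_contra h2
  push Not at h2
  set x : Fin d → ℝ := fun i => (z i : ℝ) with hx
  have hev : ∀ᶠ t in nhdsWithin (1:ℝ) (Set.Iio 1), (∀ i, -t < M x i) ∧ ∑ i, M x i < t ∧ 0 < t ∧ t < 1 := by
    refine Filter.Eventually.and ?_ (Filter.Eventually.and ?_ (Filter.Eventually.and ?_ ?_))
    · rw [Filter.eventually_all]
      intro i
      refine nhdsWithin_le_nhds ?_
      filter_upwards [lt_mem_nhds (show -(M x i) < 1 by linarith [h1 i])] with t ht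
      linarith
    · exact nhdsWithin_le_nhds (lt_mem_nhds h2)
    · exact nhdsWithin_le_nhds (lt_mem_nhds one_pos)
    · exact self_mem_nhdsWithin
  obtain ⟨t, ht1, ht2, ht0, ht⟩ := hev.exists
  have hl1' : l1 = (n:ℝ)⁻¹ := by rw [← hln, inv_inv]
  have hle := hl1.2 (show t / n ∈ _ from ⟨by positivity, z, by
    intro h
    apply hz
    ext i
    have := congrFun h i
    simpa using this, by
    rw [Set.mem_smul_set_iff_inv_smul_mem₀ (by positivity), hS']
    have hp : 0 < (t / n)⁻¹ := by positivity
    have e : (n:ℝ) = (t/n)⁻¹ * t := by field_simp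
    simp only [Set.mem_ofPred_eq, map_smul, Pi.smul_apply, smul_eq_mul, ← Finset.mul_sum]
    constructor
    · intro i
      have := mul_le_mul_of_nonneg_left (ht1 i).le hp.le
      linarith
    · have := mul_le_mul_of_nonneg_left ht2.le hp.le
      linarith⟩)
  rw [hl1', ← one_div, div_le_div_iff_of_pos_right hn'] at hle
  linarith
end

section
/- Let K be a convex body in ℝ² with centroid at the origin such that the origin is the only interior lattice point of K, i.e., int(K) ∩ ℤ² = {0}. Then #(K ∩ ℤ²) ≤ 10. -/
open MeasureTheory Set Pointwise

/-- The set of integer lattice points of `ℝ²`. -/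
def latticePts2 : Set (Fin 2 → ℝ) := {x | ∀ i, ∃ z : ℤ, x i = (z : ℝ)}


def SupH (T : Finset (ℤ × ℤ)) : Prop := ∀ z : ℤ × ℤ, z ≠ 0 → ∃ α β : ℝ, 0 < α * z.1 + β * z.2 ∧
  ∀ w ∈ T, α * w.1 + β * w.2 ≤ α * z.1 + β * z.2 ∧ -3 * (α * z.1 + β * z.2) < α * w.1 + β * w.2

def MidH (T : Finset (ℤ × ℤ)) : Prop := ∀ x ∈ T, ∀ y ∈ T, ∀ z : ℤ × ℤ, x + y = z + z → z ∈ T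

def par (z : ℤ × ℤ) : ZMod 2 × ZMod 2 := ((z.1 : ZMod 2), (z.2 : ZMod 2))

lemma par_add (x y : ℤ × ℤ) : par (x + y) = par x + par y := by
  simp [par]

lemma par_sub (x y : ℤ × ℤ) : par (x - y) = par x - par y := by
  simp [par]

lemma par_neg (x : ℤ × ℤ) : par (-x) = par x := by
  have h : ∀ a : ZMod 2, -a = a := by decide
  simp [par, h]

lemma par_zero_iff (x : ℤ × ℤ) : par x = 0 ↔ ∃ z, x = z + z := by
  constructor
  · intro h
    have h1 : ((x.1 : ℤ) : ZMod 2) = 0 := congrArg Prod.fst h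
    have h2 : ((x.2 : ℤ) : ZMod 2) = 0 := congrArg Prod.snd h
    rw [ZMod.intCast_zmod_eq_zero_iff_dvd] at h1 h2
    obtain ⟨a, ha⟩ := h1
    obtain ⟨b, hb⟩ := h2
    refine ⟨(a, b), ?_⟩
    ext <;> simp <;> push_cast at * <;> omega
  · rintro ⟨z, rfl⟩
    have h : ∀ a : ZMod 2 × ZMod 2, a + a = 0 := by decide
    rw [par_add, h]

lemma par_eq_iff (x y : ℤ × ℤ) : par x = par y ↔ ∃ z, x = y + (z + z) := by
  rw [← sub_eq_zero, ← par_sub, par_zero_iff]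
  constructor
  · rintro ⟨z, h⟩
    exact ⟨z, by rw [← h]; abel⟩
  · rintro ⟨z, h⟩
    exact ⟨z, by rw [h]; abel⟩

lemma comb2 {T : Finset (ℤ × ℤ)} (hs : SupH T) {x y z : ℤ × ℤ} (hx : x ∈ T) (hy : y ∈ T)
    (m n k : ℕ) (hk : m + n < k) (h : m • x + n • y = k • z) : z = 0 := by
  by_contra hz
  obtain ⟨α, β, hp, hw⟩ := hs z hz
  have h1 := (hw x hx).1
  have h2 := (hw y hy).1
  have e1 : (m : ℝ) * x.1 + n * y.1 = k * z.1 := by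
    have := congrArg Prod.fst h; simp at this; exact_mod_cast this
  have e2 : (m : ℝ) * x.2 + n * y.2 = k * z.2 := by
    have := congrArg Prod.snd h; simp at this; exact_mod_cast this
  have hk' : (m : ℝ) + n < k := by exact_mod_cast hk
  set F := α * z.1 + β * z.2 with hF
  have a1 := mul_le_mul_of_nonneg_left h1 (Nat.cast_nonneg (α := ℝ) m)
  have a2 := mul_le_mul_of_nonneg_left h2 (Nat.cast_nonneg (α := ℝ) n)
  have a3 := mul_lt_mul_of_pos_right hk' hp
  have : (k : ℝ) * F = m * (α * x.1 + β * x.2) + n * (α * y.1 + β * y.2) := by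
    rw [hF]; linear_combination - α * e1 - β * e2
  linarith

lemma even_zero {T : Finset (ℤ × ℤ)} (hs : SupH T) {x : ℤ × ℤ} (hx : x ∈ T) (h : par x = 0) :
    x = 0 := by
  obtain ⟨z, rfl⟩ := (par_zero_iff x).1 h
  have : z = 0 := comb2 hs hx hx 1 0 2 (by norm_num) (by simp [two_smul])
  simp [this]

lemma diff4 {T : Finset (ℤ × ℤ)} (hs : SupH T) {x y z : ℤ × ℤ} (hx : x ∈ T) (hy : y ∈ T)
    (h : x = y + 4 • z) : z = 0 := by
  by_contra hz
  obtain ⟨α, β, hp, hw⟩ := hs z hz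
  have h1 := (hw x hx).1
  have h2 := (hw y hy).2
  subst h
  simp at h1
  linarith

/-- four distinct points in one odd class: all distinct mod 4 -/
lemma half_ne {T : Finset (ℤ × ℤ)} (hs : SupH T) {x y a : ℤ × ℤ} (hx : x ∈ T) (hy : y ∈ T)
    (hne : x ≠ y) (h : x = y + (a + a)) : par a ≠ 0 := by
  intro h0
  obtain ⟨b, rfl⟩ := (par_zero_iff a).1 h0
  have : b = 0 := diff4 hs hx hy (z := b) (by rw [h]; abel)
  subst this
  apply hne; simpa using h

lemma odd_det {a b : ℤ × ℤ} (ha : par a ≠ 0) (hb : par b ≠ 0) (hab : par a ≠ par b) :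
    a.1 * b.2 - a.2 * b.1 ≠ 0 := by
  intro h
  have h' := congrArg (Int.cast : ℤ → ZMod 2) h
  push_cast at h'
  have key : ∀ p q : ZMod 2 × ZMod 2, p ≠ 0 → q ≠ 0 → p ≠ q → p.1 * q.2 - p.2 * q.1 ≠ 0 := by decide
  exact key _ _ ha hb hab h'

set_option synthInstance.maxSize 2000 in
set_option synthInstance.maxHeartbeats 200000 in
lemma key2aux : ∀ x p q r : ZMod 2 × ZMod 2, x ≠ 0 → p ≠ 0 → q ≠ 0 → r ≠ 0 → p ≠ q → p ≠ r → q ≠ r →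
      x + p = 0 ∨ x + q = 0 ∨ x + r = 0 := by
    have key3 : ∀ x p q r : ZMod 2 × ZMod 2, ¬ (x ≠ 0 ∧ p ≠ 0 ∧ q ≠ 0 ∧ r ≠ 0 ∧ p ≠ q ∧ p ≠ r ∧ q ≠ r ∧
      x + p ≠ 0 ∧ x + q ≠ 0 ∧ x + r ≠ 0) := by decide
    intro x p q r
    have := key3 x p q r
    tauto

lemma four {T : Finset (ℤ × ℤ)} (hs : SupH T) (hm : MidH T) {x1 x2 x3 x4 : ℤ × ℤ}
    (h1 : x1 ∈ T) (h2 : x2 ∈ T) (h3 : x3 ∈ T) (h4 : x4 ∈ T)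
    (n12 : x1 ≠ x2) (n13 : x1 ≠ x3) (n14 : x1 ≠ x4) (n23 : x2 ≠ x3) (n24 : x2 ≠ x4) (n34 : x3 ≠ x4)
    (p0 : par x1 ≠ 0) (p2 : par x2 = par x1) (p3 : par x3 = par x1) (p4 : par x4 = par x1) :
    ∃ u v : ℤ × ℤ, u ∈ T ∧ v ∈ T ∧ -u ∈ T ∧ -v ∈ T ∧ u + v ∈ T ∧ u - v ∈ T ∧ -u + v ∈ T ∧ -u - v ∈ T ∧
      par u ≠ 0 ∧ par v ≠ 0 ∧ par u ≠ par v ∧ par (u + v) = par x1 := by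
  obtain ⟨a, ha⟩ := (par_eq_iff _ _).1 p2
  obtain ⟨b, hb⟩ := (par_eq_iff _ _).1 p3
  obtain ⟨c, hc⟩ := (par_eq_iff _ _).1 p4
  have qa := half_ne hs h2 h1 n12.symm ha
  have qb := half_ne hs h3 h1 n13.symm hb
  have qc := half_ne hs h4 h1 n14.symm hc
  have qab := half_ne hs h2 h3 n23 (a := a - b) (by rw [ha, hb]; abel)
  have qac := half_ne hs h2 h4 n24 (a := a - c) (by rw [ha, hc]; abel)
  have qbc := half_ne hs h3 h4 n34 (a := b - c) (by rw [hb, hc]; abel)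
  rw [par_sub, sub_ne_zero] at qab qac qbc
  have key : ∀ p q r : ZMod 2 × ZMod 2, p ≠ 0 → q ≠ 0 → r ≠ 0 → p ≠ q → p ≠ r → q ≠ r → p + q + r = 0 := by
    decide
  have hsum : par (a + b + c) = 0 := by
    rw [par_add, par_add]; exact key _ _ _ qa qb qc qab qac qbc
  obtain ⟨e, he⟩ := (par_zero_iff _).1 hsum
  -- g = x1 + e is the centroid
  have hg : x1 + e = 0 := by
    by_contra hg
    obtain ⟨α, β, hp, hw⟩ := hs _ hg
    have w1 := (hw _ h1).1
    have w2 := (hw _ h2).1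
    have w3 := (hw _ h3).1
    have w4 := (hw _ h4).1
    have he1 : (a.1 : ℝ) + b.1 + c.1 = e.1 + e.1 := by exact_mod_cast congrArg Prod.fst he
    have he2 : (a.2 : ℝ) + b.2 + c.2 = e.2 + e.2 := by exact_mod_cast congrArg Prod.snd he
    rw [ha] at w2
    rw [hb] at w3
    rw [hc] at w4
    simp only [Prod.fst_add, Prod.snd_add] at w1 w2 w3 w4 hp
    push_cast at w1 w2 w3 w4 hp
    have he3 : α * a.1 + β * a.2 + (α * b.1 + β * b.2) + (α * c.1 + β * c.2)
      = 2 * (α * e.1 + β * e.2) := by linear_combination α * he1 + β * he2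
    have fa : α * a.1 + β * a.2 = 0 := by linarith
    have fb : α * b.1 + β * b.2 = 0 := by linarith
    have hd : (a.1 * b.2 - a.2 * b.1 : ℝ) ≠ 0 := by exact_mod_cast odd_det qa qb qab
    have α0 : α = 0 := by
      have : α * (a.1 * b.2 - a.2 * b.1 : ℝ) = 0 := by linear_combination b.2 * fa - a.2 * fb
      simpa [hd] using this
    have β0 : β = 0 := by
      have : β * (a.1 * b.2 - a.2 * b.1 : ℝ) = 0 := by linear_combination -b.1 * fa + a.1 * fb
      simpa [hd] using this
    simp [α0, β0] at hp
  have m2 : x1 + a ∈ T := hm _ h1 _ h2 _ (by rw [ha]; abel)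
  have m3 : x1 + b ∈ T := hm _ h1 _ h3 _ (by rw [hb]; abel)
  have m4 : x1 + c ∈ T := hm _ h1 _ h4 _ (by rw [hc]; abel)
  -- one is even
  have key2 := key2aux
  have main : ∀ x y : ℤ × ℤ, x ∈ T → -x ∈ T → y ∈ T → -y ∈ T → x ≠ y → x ≠ -y → par x ≠ 0 → par y = par x →
      par x = par x1 →
      ∃ u v : ℤ × ℤ, u ∈ T ∧ v ∈ T ∧ -u ∈ T ∧ -v ∈ T ∧ u + v ∈ T ∧ u - v ∈ T ∧ -u + v ∈ T ∧ -u - v ∈ T ∧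
      par u ≠ 0 ∧ par v ≠ 0 ∧ par u ≠ par v ∧ par (u + v) = par x1 := by
    intro x y hx hx' hy hy' hxy hxy' hpx hpy hpx1
    obtain ⟨w, hw⟩ := (par_eq_iff _ _).1 hpy
    have hu : x + w ∈ T := hm _ hx _ hy _ (by rw [hw]; abel)
    have hv : -w ∈ T := hm _ hx _ hy' _ (by rw [hw]; abel)
    have hu' : -(x + w) ∈ T := hm _ hx' _ hy' _ (by rw [hw]; abel)
    have hv' : - -w ∈ T := hm _ hx' _ hy _ (by rw [hw]; abel)
    have e1 : x + w + -w = x := by abel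
    have e2 : x + w - -w = y := by rw [hw]; abel
    have e3 : -(x + w) + -w = -y := by rw [hw]; abel
    have e4 : -(x + w) - -w = -x := by abel
    refine ⟨x + w, -w, hu, hv, hu', hv', by rwa [e1], by rwa [e2], by rwa [e3], by rwa [e4], ?_, ?_, ?_, by rw [e1, hpx1]⟩
    · intro h
      have := even_zero hs hu h
      apply hxy'
      rw [hw]
      have h3 : w = -x := by rw [eq_neg_iff_add_eq_zero, add_comm]; exact this
      rw [h3]; abel
    · intro h
      have := even_zero hs hv h
      apply hxy
      rw [hw, neg_eq_zero.1 this]; simp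
    · intro h
      apply hpx
      rw [← e1, par_add, h]
      have h : ∀ a : ZMod 2 × ZMod 2, a + a = 0 := by decide
      exact h _
  have fin : ∀ y2 y3 y4 : ℤ × ℤ, y2 ∈ T → y3 ∈ T → y4 ∈ T → x1 ≠ y3 → y2 ≠ y3 → par y3 = par x1 →
      x1 + y2 = 0 → y3 + y4 = 0 → ∃ u v : ℤ × ℤ, u ∈ T ∧ v ∈ T ∧ -u ∈ T ∧ -v ∈ T ∧ u + v ∈ T ∧ u - v ∈ T ∧ -u + v ∈ T ∧ -u - v ∈ T ∧
      par u ≠ 0 ∧ par v ≠ 0 ∧ par u ≠ par v ∧ par (u + v) = par x1 := by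
    intro y2 y3 y4 k2 k3 k4 n13 n23 q3 s12 s34
    obtain rfl := eq_neg_of_add_eq_zero_right s12
    obtain rfl := eq_neg_of_add_eq_zero_right s34
    exact main x1 y3 h1 k2 k3 k4 n13 (fun h => n23 (by rw [h]; simp)) p0 q3 rfl
  have tot : x1 + x2 + (x3 + x4) = 0 := by
    have : x1 + x2 + (x3 + x4) = 4 • x1 + 2 • (a + b + c) := by rw [ha, hb, hc]; abel
    rw [this, he]
    have : 4 • x1 + 2 • (e + e) = 4 • (x1 + e) := by abel
    rw [this, hg]; simp
  rcases key2 _ _ _ _ p0 qa qb qc qab qac qbc with h | h | h <;> rw [← par_add] at h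
  · have h0 := even_zero hs m2 h
    have s : x1 + x2 = 0 := by
      rw [ha, show x1 + (x1 + (a + a)) = (x1 + a) + (x1 + a) by abel, h0]; simp
    exact fin x2 x3 x4 h2 h3 h4 n13 n23 p3 s (by rw [s] at tot; simpa using tot)
  · have h0 := even_zero hs m3 h
    have s : x1 + x3 = 0 := by
      rw [hb, show x1 + (x1 + (b + b)) = (x1 + b) + (x1 + b) by abel, h0]; simp
    exact fin x3 x2 x4 h3 h2 h4 n12 n23.symm p2 s (by
      rw [show x1 + x2 + (x3 + x4) = x1 + x3 + (x2 + x4) by abel, s] at tot; simpa using tot)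
  · have h0 := even_zero hs m4 h
    have s : x1 + x4 = 0 := by
      rw [hc, show x1 + (x1 + (c + c)) = (x1 + c) + (x1 + c) by abel, h0]; simp
    exact fin x4 x2 x3 h4 h2 h3 n12 n24.symm p2 s (by
      rw [show x1 + x2 + (x3 + x4) = x1 + x4 + (x2 + x3) by abel, s] at tot; simpa using tot)

set_option synthInstance.maxSize 2000 in
set_option synthInstance.maxHeartbeats 200000 in
/-- the class of `u+v` consists only of the four vertices -/
lemma full {T : Finset (ℤ × ℤ)} (hs : SupH T) {u v q : ℤ × ℤ}
    (h1 : u + v ∈ T) (h2 : u - v ∈ T) (h3 : -u + v ∈ T) (h4 : -u - v ∈ T)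
    (pu : par u ≠ 0) (pv : par v ≠ 0) (puv : par u ≠ par v) (hq : q ∈ T) (pq : par q = par (u + v)) :
    q = u + v ∨ q = u - v ∨ q = -u + v ∨ q = -u - v := by
  obtain ⟨w, rfl⟩ := (par_eq_iff _ _).1 pq
  have key : ∀ a b c : ZMod 2 × ZMod 2, a ≠ 0 → b ≠ 0 → a ≠ b →
    c = 0 ∨ c + b = 0 ∨ c + a = 0 ∨ c + (a + b) = 0 := by decide
  rcases key _ _ (par w) pu pv puv with h | h | h | h
  · left
    by_contra hne
    exact half_ne hs hq h1 hne rfl h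
  · right; left
    by_contra hne
    exact half_ne hs hq h2 hne (a := w + v) (by abel) (by rw [par_add, h])
  · right; right; left
    by_contra hne
    exact half_ne hs hq h3 hne (a := w + u) (by abel) (by rw [par_add, h])
  · right; right; right
    by_contra hne
    exact half_ne hs hq h4 hne (a := w + (u + v)) (by abel) (by rw [par_add, par_add, h])

set_option synthInstance.maxSize 2000 in
set_option synthInstance.maxHeartbeats 200000 in
lemma onlyu {T : Finset (ℤ × ℤ)} (hs : SupH T) (hm : MidH T) {u v p : ℤ × ℤ}
    (hu : u ∈ T) (hu' : -u ∈ T)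
    (h1 : u + v ∈ T) (h2 : u - v ∈ T) (h3 : -u + v ∈ T) (h4 : -u - v ∈ T)
    (pu : par u ≠ 0) (pv : par v ≠ 0) (puv : par u ≠ par v) (hp : p ∈ T) (pp : par p = par u) :
    p = u ∨ p = -u := by
  obtain ⟨r, rfl⟩ := (par_eq_iff _ _).1 pp
  have hr : r ∈ T := hm _ hp _ hu' _ (by abel)
  have hr' : u + r ∈ T := hm _ hp _ hu _ (by abel)
  have key : ∀ a b c : ZMod 2 × ZMod 2, a ≠ 0 → b ≠ 0 → a ≠ b →
    c = 0 ∨ a + c = 0 ∨ c = a + b ∨ a + c = a + b := by decide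
  have nu : u ≠ 0 := by rintro rfl; simp [par] at pu
  have nv : v ≠ 0 := by rintro rfl; simp [par] at pv
  rcases key _ _ (par r) pu pv puv with h | h | h | h
  · left; rw [even_zero hs hr h]; simp
  · right
    have := even_zero hs hr' (by rw [par_add, h])
    rw [← add_assoc, this, eq_neg_of_add_eq_zero_right this]; simp
  · exfalso
    rcases full hs h1 h2 h3 h4 pu pv puv hr (by rw [par_add, h]) with rfl | rfl | rfl | rfl
    · exact nu (comb2 hs hp h2 1 2 5 (by norm_num) (by abel))
    · exact nu (comb2 hs hp h1 1 2 5 (by norm_num) (by abel))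
    · exact nv (comb2 hs hp h1 1 1 3 (by norm_num) (by abel))
    · exact nv (neg_eq_zero.1 (comb2 hs hp h2 1 1 3 (by norm_num) (by abel)))
  · exfalso
    rcases full hs h1 h2 h3 h4 pu pv puv hr' (by rw [par_add, par_add, h]) with h | h | h | h <;>
      rw [← add_assoc, h] at hp
    · obtain rfl : r = v := by simpa using h
      exact nv (comb2 hs hp h3 1 1 3 (by norm_num) (by abel))
    · obtain rfl : r = -v := by rw [← add_right_inj u, h]; abel
      exact nv (neg_eq_zero.1 (comb2 hs hp h4 1 1 3 (by norm_num) (by abel)))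
    · obtain rfl : r = -u - u + v := by rw [← add_right_inj u, h]; abel
      exact nu (neg_eq_zero.1 (comb2 hs hp h4 1 2 5 (by norm_num) (by abel)))
    · obtain rfl : r = -u - u - v := by rw [← add_right_inj u, h]; abel
      exact nu (neg_eq_zero.1 (comb2 hs hp h3 1 2 5 (by norm_num) (by abel)))

lemma comb (T : Finset (ℤ × ℤ)) (hs : SupH T) (hm : MidH T) : T.card ≤ 10 := by
  classical
  have hsum : T.card = ∑ c : ZMod 2 × ZMod 2, (T.filter (fun z => par z = c)).card :=
    Finset.card_eq_sum_card_fiberwise (fun _ _ => Finset.mem_coe.2 (Finset.mem_univ _))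
  have hz : (T.filter (fun z => par z = 0)).card ≤ 1 := by
    rw [Finset.card_le_one]
    intro a ha b hb
    rw [Finset.mem_filter] at ha hb
    rw [even_zero hs ha.1 ha.2, even_zero hs hb.1 hb.2]
  by_cases H : ∀ c, c ≠ 0 → (T.filter (fun z => par z = c)).card ≤ 3
  · rw [hsum, ← Finset.add_sum_erase _ _ (Finset.mem_univ 0)]
    have : ∑ c ∈ (Finset.univ : Finset (ZMod 2 × ZMod 2)).erase 0, (T.filter (fun z => par z = c)).card ≤
      ((Finset.univ : Finset (ZMod 2 × ZMod 2)).erase 0).card • 3 :=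
      Finset.sum_le_card_nsmul _ _ _ (fun c hc => H c (Finset.ne_of_mem_erase hc))
    have h3 : ((Finset.univ : Finset (ZMod 2 × ZMod 2)).erase 0).card = 3 := by decide
    rw [h3] at this
    simp only [smul_eq_mul] at this
    omega
  · push Not at H
    obtain ⟨c, hc0, hc⟩ := H
    obtain ⟨x1, h1, x2, h2, x3, h3, x4, h4, n12, n13, n14, n23, n24, n34⟩ := Finset.three_lt_card.1 hc
    rw [Finset.mem_filter] at h1 h2 h3 h4
    obtain ⟨u, v, hu, hv, hu', hv', k1, k2, k3, k4, pu, pv, puv, -⟩ :=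
      four hs hm h1.1 h2.1 h3.1 h4.1 n12 n13 n14 n23 n24 n34 (by rw [h1.2]; exact hc0)
        (by rw [h2.2, h1.2]) (by rw [h3.2, h1.2]) (by rw [h4.2, h1.2])
    have hsub : T ⊆ {0, u + v, u - v, -u + v, -u - v, u, -u, v, -v} := by
      intro p hp
      have key : ∀ a b c : ZMod 2 × ZMod 2, ¬ (a ≠ 0 ∧ b ≠ 0 ∧ a ≠ b ∧
        c ≠ 0 ∧ c ≠ a ∧ c ≠ b ∧ c ≠ a + b) := by decide
      have key' : par p = 0 ∨ par p = par u ∨ par p = par v ∨ par p = par u + par v := by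
        have := key (par u) (par v) (par p)
        tauto
      simp only [Finset.mem_insert, Finset.mem_singleton]
      rcases key' with h | h | h | h
      · have := even_zero hs hp h
        tauto
      · have := onlyu hs hm hu hu' k1 k2 k3 k4 pu pv puv hp h
        tauto
      · have := onlyu hs hm hv hv' (by rwa [add_comm]) (by rwa [sub_eq_neg_add])
          (by rwa [neg_add_eq_sub]) (by rwa [← neg_add', add_comm, neg_add']) pv pu puv.symm hp h
        tauto
      · have := full hs k1 k2 k3 k4 pu pv puv hp (by rw [par_add, h])
        tauto
    refine (Finset.card_le_card hsub).trans ?_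
    refine (Finset.card_insert_le _ _).trans (Nat.succ_le_succ ?_)
    refine (Finset.card_insert_le _ _).trans (Nat.succ_le_succ ?_)
    refine (Finset.card_insert_le _ _).trans (Nat.succ_le_succ ?_)
    exact Finset.card_le_six.trans (by norm_num)

lemma cent_bound {K : Set (Fin 2 → ℝ)} (hc : IsCompact K) (hK : Convex ℝ K)
    (hv : 0 < volume.real K)
    (h0 : ∫ x in K, x = 0) (f : StrongDual ℝ (Fin 2 → ℝ)) {y : Fin 2 → ℝ} (hy : y ∈ K) {M : ℝ}
    (hM : ∀ x ∈ K, f x ≤ M) : -f y * 271 ≤ 190 * (M - f y) := by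
  set L : Set (Fin 2 → ℝ) := (fun x => x + y) ⁻¹' K with hL
  have mp : MeasurePreserving (fun x : Fin 2 → ℝ => x + y) volume volume := measurePreserving_add_right _ _
  have emb : MeasurableEmbedding (fun x : Fin 2 → ℝ => x + y) := measurableEmbedding_addRight y
  have hLc : IsCompact L := (Homeomorph.addRight y).isCompact_preimage.2 hc
  have hLv : volume.real L = volume.real K := by
    rw [measureReal_def, measureReal_def, mp.measure_preimage_emb emb]
  have hL0 : (0 : Fin 2 → ℝ) ∈ L := by simpa [hL] using hy
  have hLconv : Convex ℝ L := hK.translate_preimage_left y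
  have hidK : IntegrableOn (fun x : Fin 2 → ℝ => x) K := continuous_id.continuousOn.integrableOn_compact hc
  have hfK : IntegrableOn (fun x => f x) K := f.continuous.continuousOn.integrableOn_compact hc
  have hfL : IntegrableOn (fun x => f x) L := f.continuous.continuousOn.integrableOn_compact hLc
  have i0 : ∫ x in K, f x = 0 := by
    rw [f.integral_comp_comm hidK, h0, map_zero]
  have i1 : ∫ w in L, f w = - f y * volume.real K := by
    have := mp.setIntegral_preimage_emb emb (fun x => f x - f y) K
    simp only [map_add, add_sub_cancel_right] at this
    rw [hL, this, integral_sub hfK (integrableOn_const hc.measure_lt_top.ne), i0]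
    simp
    ring
  have ht : (0 : ℝ) < 9 / 10 := by norm_num
  have hsub : (9 / 10 : ℝ) • L ⊆ L := by
    rintro _ ⟨w, hw, rfl⟩
    exact hLconv.smul_mem_of_zero_mem hL0 hw ⟨by norm_num, by norm_num⟩
  have htc : IsCompact ((9 / 10 : ℝ) • L) := hLc.smul _
  have i2 : ∫ w in (9 / 10 : ℝ) • L, f w = (9 / 10) ^ 3 * ∫ w in L, f w := by
    have := Measure.setIntegral_comp_smul_of_pos volume (fun x => f x) L ht
    simp only [map_smul, smul_eq_mul, integral_const_mul, Module.finrank_fin_fun] at this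
    rw [eq_comm, inv_mul_eq_iff_eq_mul₀ (by norm_num)] at this
    rw [this]; ring
  have hvt : volume.real ((9 / 10 : ℝ) • L) = (9 / 10) ^ 2 * volume.real L := by
    rw [measureReal_def, Measure.addHaar_smul, ENNReal.toReal_mul, measureReal_def]
    simp only [Module.finrank_fin_fun]
    rw [ENNReal.toReal_ofReal (abs_nonneg _), abs_of_nonneg (by positivity)]
  have i3 : ∫ w in L \ (9 / 10 : ℝ) • L, f w = (∫ w in L, f w) - ∫ w in (9 / 10 : ℝ) • L, f w :=
    setIntegral_sdiff htc.measurableSet hfL hsub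
  have hvd : volume.real (L \ (9 / 10 : ℝ) • L) = volume.real L - volume.real ((9 / 10 : ℝ) • L) :=
    measureReal_sdiff hsub htc.measurableSet hLc.measure_lt_top.ne
  have hfin : volume (L \ (9 / 10 : ℝ) • L) ≠ ⊤ := ((measure_mono diff_subset).trans_lt hLc.measure_lt_top).ne
  have i4 : ∫ w in L \ (9 / 10 : ℝ) • L, f w ≤ ∫ w in L \ (9 / 10 : ℝ) • L, (M - f y) := by
    apply setIntegral_mono_on (hfL.mono_set diff_subset) (integrableOn_const hfin)
      (hLc.measurableSet.diff htc.measurableSet)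
    intro w hw
    have := hM _ hw.1
    simp at this
    linarith
  rw [setIntegral_const, hvd, hvt, i3, i2, i1, hLv, smul_eq_mul] at i4
  have : volume.real K * (-f y * 271) ≤ volume.real K * (190 * (M - f y)) := by nlinarith
  exact le_of_mul_le_mul_left this hv

def emb (z : ℤ × ℤ) : Fin 2 → ℝ := ![(z.1 : ℝ), (z.2 : ℝ)]

lemma emb_inj : Function.Injective emb := by
  intro a b h
  have h0 := congrFun h 0
  have h1 := congrFun h 1
  simp [emb] at h0 h1
  exact Prod.ext h0 h1

lemma range_emb : latticePts2 = range emb := by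
  ext x
  constructor
  · intro h
    obtain ⟨a, ha⟩ := h 0
    obtain ⟨b, hb⟩ := h 1
    refine ⟨(a, b), ?_⟩
    ext i; fin_cases i <;> simp [emb, ha, hb]
  · rintro ⟨z, rfl⟩ i
    fin_cases i
    · exact ⟨z.1, rfl⟩
    · exact ⟨z.2, rfl⟩

lemma f_emb (f : StrongDual ℝ (Fin 2 → ℝ)) (z : ℤ × ℤ) :
    f (emb z) = f ![1, 0] * z.1 + f ![0, 1] * z.2 := by
  have : emb z = (z.1 : ℝ) • ![1, 0] + (z.2 : ℝ) • ![0, 1] := by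
    ext i; fin_cases i <;> simp [emb]
  rw [this, map_add, map_smul, map_smul, smul_eq_mul, smul_eq_mul]
  ring

theorem planar_lattice_point_bound (K : Set (Fin 2 → ℝ))
    (hKcpt : IsCompact K) (hKconv : Convex ℝ K) (hKint : (interior K).Nonempty)
    (hcent : (⨍ x in K, x) = (0 : Fin 2 → ℝ))
    (honly : interior K ∩ latticePts2 = {0}) :
    Set.ncard (K ∩ latticePts2) ≤ 10 := by
  have hvpos : 0 < volume.real K := by
    rw [measureReal_def]
    exact ENNReal.toReal_pos (Measure.measure_pos_of_nonempty_interior _ hKint).ne'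
      hKcpt.measure_lt_top.ne
  have h0 : ∫ x in K, x = 0 := by
    rw [setAverage_eq, smul_eq_zero] at hcent
    rcases hcent with h | h
    · exact absurd h (inv_ne_zero hvpos.ne')
    · exact h
  have hz : (0 : Fin 2 → ℝ) ∈ interior K := by
    have : (0 : Fin 2 → ℝ) ∈ interior K ∩ latticePts2 := by rw [honly]; rfl
    exact this.1
  have him : K ∩ latticePts2 = emb '' (emb ⁻¹' K) := by
    rw [image_preimage_eq_inter_range, range_emb]
  rw [him, ncard_image_of_injective _ emb_inj]
  by_cases hfin : (emb ⁻¹' K).Finite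
  swap
  · rw [Set.Infinite.ncard hfin]; norm_num
  rw [ncard_eq_toFinset_card _ hfin]
  apply comb
  · intro z hzne
    have hzi : emb z ∉ interior K := by
      intro h
      have : emb z ∈ interior K ∩ latticePts2 := ⟨h, by rw [range_emb]; exact ⟨z, rfl⟩⟩
      rw [honly] at this
      apply hzne
      apply emb_inj
      rw [mem_singleton_iff.1 this]
      ext i; fin_cases i <;> simp [emb]
    obtain ⟨f, hf⟩ := geometric_hahn_banach_open_point hKconv.interior isOpen_interior hzi
    have hpos : 0 < f (emb z) := by simpa using hf 0 hz
    have hle : ∀ x ∈ K, f x ≤ f (emb z) := by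
      intro x hx
      have hx' : x ∈ closure (interior K) := by
        rw [hKconv.closure_interior_eq_closure_of_nonempty_interior hKint]
        exact subset_closure hx
      exact closure_minimal (fun a ha => (hf a ha).le)
        (isClosed_le f.continuous continuous_const) hx'
    refine ⟨f ![1, 0], f ![0, 1], ?_, ?_⟩
    · rwa [← f_emb]
    · intro w hw
      have hw' : emb w ∈ K := by simpa using hw
      rw [← f_emb, ← f_emb]
      refine ⟨hle _ hw', ?_⟩
      have := cent_bound hKcpt hKconv hvpos h0 f hw' hle
      linarith
  · intro x hx y hy z hxyz
    have hx' : emb x ∈ K := by simpa using hx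
    have hy' : emb y ∈ K := by simpa using hy
    have : emb z ∈ K := by
      have e : emb z = (1 / 2 : ℝ) • emb x + (1 / 2 : ℝ) • emb y := by
        have e1 : (x.1 : ℝ) + y.1 = z.1 + z.1 := by exact_mod_cast congrArg Prod.fst hxyz
        have e2 : (x.2 : ℝ) + y.2 = z.2 + z.2 := by exact_mod_cast congrArg Prod.snd hxyz
        ext i; fin_cases i <;> simp [emb] <;> linarith
      rw [e]
      exact hKconv hx' hy' (by norm_num) (by norm_num) (by norm_num)
    simpa using this
end

section
/- Let K be a convex body in ℝ² with centroid at the origin and int(K) ∩ ℤ² = {0}. Then #(K ∩ ℤ²) = 10 if and only if K is unimodularly equivalent to the triangle S_2 = conv{(−1,−1), (2,−1), (−1,2)}. -/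
open MeasureTheory Set Pointwise

/-- The triangle `S₂ = conv{(-1,-1), (2,-1), (-1,2)}`. -/
def ehrhartTriangle : Set (Fin 2 → ℝ) :=
  convexHull ℝ {![(-1 : ℝ), -1], ![2, -1], ![-1, 2]}

lemma eta2 (p : Fin 2 → ℝ) : ![p 0, p 1] = p := by
  ext i; fin_cases i <;> rfl

lemma combo2 {K : Set (Fin 2 → ℝ)} (hK : Convex ℝ K) {a b c d : ℝ}
    (h1 : ![a, b] ∈ K) (h2 : ![c, d] ∈ K) (t : ℝ) (h0 : 0 ≤ t) (ht : t ≤ 1) {e f : ℝ}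
    (he : e = (1 - t) * a + t * c) (hf : f = (1 - t) * b + t * d) : ![e, f] ∈ K := by
  have := hK h1 h2 (by linarith : 0 ≤ 1 - t) h0 (by ring)
  convert this using 1
  ext i; fin_cases i <;> simp [he, hf]

lemma tri_mem (x y : ℝ) : ![x, y] ∈ ehrhartTriangle ↔ -1 ≤ x ∧ -1 ≤ y ∧ x + y ≤ 1 := by
  constructor
  · intro h
    have hc : Convex ℝ {p : Fin 2 → ℝ | -1 ≤ p 0 ∧ -1 ≤ p 1 ∧ p 0 + p 1 ≤ 1} := by
      intro p hp q hq a b ha hb hab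
      simp only [mem_ofPred_eq, Pi.add_apply, Pi.smul_apply, smul_eq_mul] at *
      obtain rfl : b = 1 - a := by linarith
      refine ⟨?_, ?_, ?_⟩ <;> nlinarith
    have := convexHull_min (s := {![(-1 : ℝ), -1], ![2, -1], ![-1, 2]}) ?_ hc h
    · simpa using this
    · rintro p (rfl | rfl | rfl) <;> simp <;> norm_num
  · rintro ⟨h1, h2, h3⟩
    have hT : Convex ℝ ehrhartTriangle := convex_convexHull _ _
    have m1 : ![(-1 : ℝ), -1] ∈ ehrhartTriangle := subset_convexHull _ _ (by simp)
    have m2 : ![(2 : ℝ), -1] ∈ ehrhartTriangle := subset_convexHull _ _ (by simp)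
    have m3 : ![(-1 : ℝ), 2] ∈ ehrhartTriangle := subset_convexHull _ _ (by simp)
    have := hT.sum_mem (t := Finset.univ) (w := ![(1 - x - y) / 3, (x + 1) / 3, (y + 1) / 3])
      (z := ![![(-1 : ℝ), -1], ![(2 : ℝ), -1], ![(-1 : ℝ), 2]])
      (by intro i _; fin_cases i <;> simp <;> linarith)
      (by simp [Fin.sum_univ_three]; ring)
      (by intro i _; fin_cases i <;> simp [m1, m2, m3])
    convert this using 1
    ext i; fin_cases i <;> simp [Fin.sum_univ_three] <;> ring

lemma scale_interior {K : Set (Fin 2 → ℝ)} (hK : Convex ℝ K) (h0 : (0 : Fin 2 → ℝ) ∈ interior K)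
    {q : Fin 2 → ℝ} (hq : q ∈ K) {t : ℝ} (ht0 : 0 ≤ t) (ht : t < 1) : t • q ∈ interior K := by
  have := hK.combo_interior_self_mem_interior h0 hq (by linarith : 0 < 1 - t) ht0 (by ring)
  simpa using this

lemma fubini_trap (l r h : ℝ) (hh : -1 ≤ h) (hw : ∀ y ∈ Icc (-1) h, l + (l + 1) * y ≤ r + (r - 2) * y)
    (D : Set (Fin 2 → ℝ))
    (hD : D = {p | (-1 ≤ p 1 ∧ p 1 ≤ h) ∧ l + (l + 1) * p 1 ≤ p 0 ∧ p 0 ≤ r + (r - 2) * p 1}) :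
    IsCompact D ∧ ∫ p in D, p 1 = (r - l) * (h ^ 2 - 1) / 2 - (3 - (r - l)) * (h ^ 3 + 1) / 3 := by
  have hcl : IsClosed D := by
    have e : D = ({p | -1 ≤ p 1} ∩ {p | p 1 ≤ h}) ∩ ({p | l + (l + 1) * p 1 ≤ p 0} ∩ {p | p 0 ≤ r + (r - 2) * p 1}) := by
      rw [hD]; ext; simp
    rw [e]
    refine IsClosed.inter (IsClosed.inter ?_ ?_) (IsClosed.inter ?_ ?_) <;>
      refine isClosed_le ?_ ?_ <;> fun_prop
  have hcpt : IsCompact D := by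
    set M := |l| + |r| + (|l+1| + |r-2|) * (1 + |h|) with hM
    refine (isCompact_Icc (a := (![-M, -1] : Fin 2 → ℝ)) (b := ![M, h])).of_isClosed_subset hcl ?_
    intro p hp
    rw [hD] at hp
    obtain ⟨⟨a, b⟩, c, d⟩ := hp
    have hy : |p 1| ≤ 1 + |h| := by
      rw [abs_le]; constructor <;> cases abs_cases h <;> linarith
    have e1 : |(l+1) * p 1| ≤ |l+1| * (1+|h|) := by
      rw [abs_mul]; gcongr
    have e2 : |(r-2) * p 1| ≤ |r-2| * (1+|h|) := by
      rw [abs_mul]; gcongr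
    have n1 : 0 ≤ |l+1| * (1+|h|) := by positivity
    have n2 : 0 ≤ |r-2| * (1+|h|) := by positivity
    have := abs_le.1 e1
    have := abs_le.1 e2
    have := neg_abs_le l
    have := le_abs_self r
    have := abs_nonneg l
    have := abs_nonneg r
    rw [mem_Icc, Pi.le_def, Pi.le_def]
    simp [Fin.forall_fin_two]
    refine ⟨⟨?_, a⟩, ?_, b⟩ <;> rw [hM] <;> nlinarith
  refine ⟨hcpt, ?_⟩
  have hmp := volume_preserving_finTwoArrow ℝ
  have hint : Integrable (D.indicator fun p : Fin 2 → ℝ => p 1) := by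
    rw [integrable_indicator_iff hcl.measurableSet]
    exact (continuous_apply 1).continuousOn.integrableOn_compact hcpt
  rw [← integral_indicator hcl.measurableSet]
  set F : ℝ × ℝ → ℝ := fun q => D.indicator (fun p : Fin 2 → ℝ => p 1) ![q.1, q.2] with hF
  have hFe : ∀ p, D.indicator (fun p : Fin 2 → ℝ => p 1) p = F (MeasurableEquiv.finTwoArrow p) := by
    intro p; simp [hF, MeasurableEquiv.finTwoArrow, eta2]
  simp_rw [hFe] at hint ⊢
  rw [hmp.integral_comp (MeasurableEquiv.measurableEmbedding _)]
  have hFi : Integrable F := (hmp.integrable_comp_emb (MeasurableEquiv.measurableEmbedding _)).1 (by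
    convert hint using 1; funext p; exact (hFe p).symm)
  rw [Measure.volume_eq_prod] at hFi ⊢
  rw [integral_prod_symm _ hFi]
  have inner : ∀ y, ∫ x, F (x, y) = (Icc (-1) h).indicator (fun y => y * ((r + (r - 2) * y) - (l + (l + 1) * y))) y := by
    intro y
    by_cases hy : y ∈ Icc (-1) h
    · rw [indicator_of_mem hy]
      have : (fun x => F (x, y)) = (Icc (l + (l + 1) * y) (r + (r - 2) * y)).indicator (fun _ => y) := by
        ext x
        simp only [hF, indicator, hD]
        have := hy.1
        have := hy.2
        simp [*]
      rw [this, integral_indicator measurableSet_Icc, setIntegral_const]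
      simp [hw y hy, Measure.real]
      ring
    · rw [indicator_of_notMem hy]
      have : (fun x => F (x, y)) = fun _ => 0 := by
        ext x
        simp only [hF, indicator, hD]
        rw [if_neg]
        rintro ⟨a, b⟩
        exact hy (by simpa using a)
      rw [this]; simp
  simp_rw [inner]
  rw [integral_indicator measurableSet_Icc, integral_Icc_eq_integral_Ioc, ← intervalIntegral.integral_of_le hh]
  have : (fun y : ℝ => y * ((r + (r - 2) * y) - (l + (l + 1) * y))) = fun y => (r - l) * y - (3 - (r - l)) * y ^ 2 := by
    ext; ring
  rw [this, intervalIntegral.integral_sub (by apply Continuous.intervalIntegrable; fun_prop) (by apply Continuous.intervalIntegrable; fun_prop)]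
  rw [intervalIntegral.integral_const_mul, intervalIntegral.integral_const_mul, integral_id, integral_pow]
  norm_num
  ring

lemma core_s5 (K : Set (Fin 2 → ℝ)) (hc : IsCompact K) (hK : Convex ℝ K)
    (h0 : (0 : Fin 2 → ℝ) ∈ interior K) (n1 : ![(1 : ℝ), 0] ∉ interior K)
    (n2 : ![(-1 : ℝ), 0] ∉ interior K) (n3 : ![(0 : ℝ), -1] ∉ interior K)
    (m1 : ![(-1 : ℝ), -1] ∈ K) (m2 : ![(2 : ℝ), -1] ∈ K) (hcent : ∫ p in K, p 1 = 0) :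
    K = ehrhartTriangle := by
  -- below
  have hbelow : ∀ x y, ![x, y] ∈ K → -1 ≤ y := by
    intro x y hxy
    by_contra! hy
    apply n3
    set t := 1 / (2 + |x|) with ht
    have hp : 0 < 2 + |x| := by positivity
    have ht0 : 0 < t := by positivity
    have ht1 : t < 1 := by rw [ht, div_lt_one hp]; linarith [abs_nonneg x]
    have htx : t * (2 + |x|) = 1 := by rw [ht]; field_simp
    set c := - t * x / (1 - t) with hcc
    have h1t : 0 < 1 - t := by linarith
    have hc1 : c * (1 - t) = - t * x := by rw [hcc]; field_simp
    have hx1 := mul_le_mul_of_nonneg_left (le_abs_self x) ht0.le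
    have hx2 := mul_le_mul_of_nonneg_left (neg_abs_le x) ht0.le
    have c1 : -1 ≤ c := by
      by_contra! hh
      nlinarith
    have c2 : c ≤ 2 := by
      by_contra! hh
      nlinarith
    have hcm : ![c, -1] ∈ K := combo2 hK m1 m2 ((c + 1) / 3) (by linarith) (by linarith) (by ring) (by ring)
    have hq : ![0, -1 + t * (y + 1)] ∈ K := combo2 hK hcm hxy t ht0.le ht1.le (by linarith) (by ring)
    have hneg : t * (y + 1) < 0 := mul_neg_of_pos_of_neg ht0 (by linarith)
    have := scale_interior hK h0 hq (t := 1 / (1 - t * (y+1))) (by apply div_nonneg <;> linarith)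
      (by rw [div_lt_one] <;> linarith)
    convert this using 1
    have : 1 - t * (y + 1) ≠ 0 := by linarith
    ext i; fin_cases i
    · simp
    · simp; field_simp; ring
  have hsec : ∀ x, ![x, 0] ∈ K → -1 ≤ x ∧ x ≤ 1 := by
    intro x hx
    constructor
    · by_contra! h
      apply n2
      have := scale_interior hK h0 hx (t := 1 / (-x)) (by apply div_nonneg <;> linarith)
        (by rw [div_lt_one] <;> linarith)
      convert this using 1
      have : x ≠ 0 := by linarith
      ext i; fin_cases i
      · simp; field_simp
      · simp
    · by_contra! h
      apply n1
      have := scale_interior hK h0 hx (t := 1 / x) (by apply div_nonneg <;> linarith)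
        (by rw [div_lt_one] <;> linarith)
      convert this using 1
      have : x ≠ 0 := by linarith
      ext i; fin_cases i
      · simp; field_simp
      · simp
  have h0K : ![(0 : ℝ), 0] ∈ K := by
    have := interior_subset h0
    rwa [← eta2 0] at this
  -- section endpoints
  set S : Set ℝ := {x | ![x, 0] ∈ K} with hS
  have hScl : IsClosed S := hc.isClosed.preimage (by fun_prop : Continuous fun x : ℝ => ![x, 0])
  have hScpt : IsCompact S := (isCompact_Icc (a := (-1 : ℝ)) (b := 1)).of_isClosed_subset hScl
    fun x hx => hsec x hx
  have hSne : S.Nonempty := ⟨0, h0K⟩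
  obtain ⟨l, hl⟩ := hScpt.exists_isLeast hSne
  obtain ⟨r, hr⟩ := hScpt.exists_isGreatest hSne
  have hlK : ![l, 0] ∈ K := hl.1
  have hrK : ![r, 0] ∈ K := hr.1
  have hlmin : ∀ x, ![x, 0] ∈ K → l ≤ x := fun x hx => hl.2 hx
  have hrmax : ∀ x, ![x, 0] ∈ K → x ≤ r := fun x hx => hr.2 hx
  have hl1 := (hsec l hlK).1
  have hr1 := (hsec r hrK).2
  have hl0 := hlmin 0 h0K
  have hr0 := hrmax 0 h0K
  -- upper part
  have hup : ∀ x y, ![x, y] ∈ K → 0 ≤ y → l + (l + 1) * y ≤ x ∧ x ≤ r + (r - 2) * y := by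
    intro x y hxy hy
    have hp : 0 < 1 + y := by linarith
    have ht0 : 0 ≤ y / (1 + y) := by positivity
    have ht1 : y / (1 + y) ≤ 1 := by rw [div_le_one hp]; linarith
    constructor
    · have := hlmin _ (combo2 hK hxy m1 (y / (1 + y)) ht0 ht1 (e := (x - y) / (1 + y)) (f := 0)
        (by field_simp; ring) (by field_simp; ring))
      rw [le_div_iff₀ hp] at this
      linarith
    · have := hrmax _ (combo2 hK hxy m2 (y / (1 + y)) ht0 ht1 (e := (x + 2 * y) / (1 + y)) (f := 0)
        (by field_simp; ring) (by field_simp; ring))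
      rw [div_le_iff₀ hp] at this
      linarith
  have hlow : ∀ x y, -1 ≤ y → y ≤ 0 → l + (l + 1) * y ≤ x → x ≤ r + (r - 2) * y → ![x, y] ∈ K := by
    intro x y hy1 hy0 ha hb
    have k1 : ![l + (l + 1) * y, y] ∈ K := combo2 hK hlK m1 (-y) (by linarith) (by linarith) (by ring) (by ring)
    have k2 : ![r + (r - 2) * y, y] ∈ K := combo2 hK hrK m2 (-y) (by linarith) (by linarith) (by ring) (by ring)
    rcases eq_or_lt_of_le (ha.trans hb) with e | e
    · have : x = l + (l + 1) * y := by linarith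
      rwa [this]
    · set a := l + (l + 1) * y
      set b := r + (r - 2) * y
      have hab : 0 < b - a := by linarith
      exact combo2 hK k1 k2 ((x - a) / (b - a)) (div_nonneg (by linarith) hab.le)
        (by rw [div_le_one hab]; linarith) (by field_simp; ring) (by ring)
  -- top
  obtain ⟨p, hpK, hpmax⟩ := hc.exists_isMaxOn ⟨_, h0K⟩ (continuous_apply 1).continuousOn
  set h := p 1 with hh
  have hmax : ∀ q ∈ K, q 1 ≤ h := fun q hq => hpmax hq
  have hh0 : 0 ≤ h := by simpa using hmax _ h0K
  have hptop := hup (p 0) h (by rw [hh, eta2]; exact hpK) hh0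
  have hh2 : 2 ≤ h := by
    by_contra! hlt
    obtain ⟨Dc, DI⟩ := fubini_trap l r h (by linarith) (by
      intro y hy
      have := hy.1
      have := hy.2
      nlinarith) _ rfl
    set D : Set (Fin 2 → ℝ) := {p | (-1 ≤ p 1 ∧ p 1 ≤ h) ∧ l + (l + 1) * p 1 ≤ p 0 ∧ p 0 ≤ r + (r - 2) * p 1} with hD
    have hle : ∫ q in K, q 1 ≤ ∫ q in D, q 1 := by
      rw [← integral_indicator hc.isClosed.measurableSet, ← integral_indicator Dc.isClosed.measurableSet]
      apply integral_mono
      · rw [integrable_indicator_iff hc.isClosed.measurableSet]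
        exact (continuous_apply 1).continuousOn.integrableOn_compact hc
      · rw [integrable_indicator_iff Dc.isClosed.measurableSet]
        exact (continuous_apply 1).continuousOn.integrableOn_compact Dc
      · intro q
        simp only [indicator]
        rcases le_total 0 (q 1) with hq | hq
        · by_cases hqK : q ∈ K
          · have : q ∈ D := ⟨⟨by linarith, hmax q hqK⟩, hup _ _ (by rwa [eta2]) hq⟩
            simp [hqK, this]
          · simp only [hqK, if_false]; split_ifs <;> linarith
        · by_cases hqD : q ∈ D
          · have : q ∈ K := by
              have := hlow _ _ hqD.1.1 hq hqD.2.1 hqD.2.2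
              rwa [eta2] at this
            simp [hqD, this]
          · simp only [hqD, if_false]; split_ifs <;> linarith
    rw [hcent, DI] at hle
    have hm : r - l ≤ 2 := by linarith
    have hm0 : 0 ≤ r - l := by linarith
    generalize r - l = m at hle hm hm0
    have a1 : 0 < (h - 2) ^ 2 * (h + 1) := by
      have : h - 2 ≠ 0 := by linarith
      positivity
    have a2 : 0 ≤ h ^ 3 := by positivity
    have : 6 * (m * (h ^ 2 - 1) / 2 - (3 - m) * (h ^ 3 + 1) / 3) = - m * ((h - 2) ^ 2 * (h + 1)) - (2 - m) * (3 * h ^ 3 + 3) := by ring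
    rcases eq_or_lt_of_le hm with e | e
    · subst e; nlinarith
    · nlinarith
  have hm : r - l = 2 := by nlinarith [hptop.1, hptop.2]
  have el : l = -1 := by linarith
  have er : r = 1 := by linarith
  subst el er
  have m3 : ![(-1 : ℝ), 2] ∈ K := by
    have e2 : p 1 = 2 := by rw [← hh]; linarith [hptop.1, hptop.2]
    have e1 : p 0 = -1 := by rw [← hh] at e2; rw [e2] at hptop; linarith [hptop.1, hptop.2]
    rw [← e1, ← e2, eta2]; exact hpK
  apply Subset.antisymm
  · intro q hq
    rw [← eta2 q] at hq ⊢
    generalize q 0 = x at hq ⊢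
    generalize q 1 = y at hq ⊢
    rw [tri_mem]
    refine ⟨?_, hbelow x y hq, ?_⟩
    · rcases le_total 0 y with hy | hy
      · linarith [(hup x y hq hy).1]
      · have hp : 0 < 2 - y := by linarith
        have := hlmin _ (combo2 hK hq m3 (-y / (2 - y)) (div_nonneg (by linarith) hp.le) (by rw [div_le_one hp]; linarith)
          (e := (2 * x + y) / (2 - y)) (f := 0) (by field_simp; ring) (by field_simp; ring))
        rw [le_div_iff₀ hp] at this
        linarith
    · rcases le_total 0 y with hy | hy
      · linarith [(hup x y hq hy).2]
      · have hp : 0 < 2 - y := by linarith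
        have := hrmax _ (combo2 hK hq m3 (-y / (2 - y)) (div_nonneg (by linarith) hp.le) (by rw [div_le_one hp]; linarith)
          (e := (2 * x + y) / (2 - y)) (f := 0) (by field_simp; ring) (by field_simp; ring))
        rw [div_le_iff₀ hp] at this
        linarith
  · apply convexHull_min _ hK
    rintro q (rfl | rfl | rfl) <;> assumption

lemma no_big_det (K : Set (Fin 2 → ℝ)) (hK : Convex ℝ K) (h0 : (0 : Fin 2 → ℝ) ∈ interior K)
    (hon : ∀ a b : ℤ, ![(a : ℝ), (b : ℝ)] ∈ interior K → a = 0 ∧ b = 0)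
    (v0 v1 x0 x1 : ℤ) (hv : IsCoprime v0 v1) (hx : ![(x0 : ℝ), (x1 : ℝ)] ∈ K)
    (hy : ![((x0 + v0 : ℤ) : ℝ), ((x1 + v1 : ℤ) : ℝ)] ∈ K) : v0 * x1 - v1 * x0 < 2 := by
  by_contra! hh
  obtain ⟨s, t, hst⟩ := hv
  set h := v0 * x1 - v1 * x0 with hdef
  -- w = (-t, s)
  set c := (h - 1) * (-t * x1 - s * x0) with hc
  set r := c % h with hr
  set k := -(c / h) with hk
  have hrk : c + k * h = r := by rw [hr, hk, Int.emod_def]; ring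
  have r0 : 0 ≤ r := Int.emod_nonneg _ (by lia)
  have r1 : r < h := Int.emod_lt_of_pos _ (by lia)
  set q0 := (h - 1) * (-t) + k * v0 with hq0
  set q1 := (h - 1) * s + k * v1 with hq1
  have e0 : h * q0 = (h - 1) * x0 + r * v0 := by
    rw [← hrk, hc, hq0, hdef]
    linear_combination (v0 * x1 - v1 * x0 - 1) * x0 * hst
  have e1 : h * q1 = (h - 1) * x1 + r * v1 := by
    rw [← hrk, hc, hq1, hdef]
    linear_combination (v0 * x1 - v1 * x0 - 1) * x1 * hst
  have hR : (2 : ℝ) ≤ h := by exact_mod_cast hh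
  have r0R : (0 : ℝ) ≤ r := by exact_mod_cast r0
  have r1R : (r : ℝ) ≤ h - 1 := by
    have : r ≤ h - 1 := by lia
    exact_mod_cast this
  have hp : (0 : ℝ) < h - 1 := by linarith
  have e0R : (h : ℝ) * q0 = (h - 1) * x0 + r * v0 := by exact_mod_cast e0
  have e1R : (h : ℝ) * q1 = (h - 1) * x1 + r * v1 := by exact_mod_cast e1
  have hmem := combo2 hK hx hy (r / (h - 1)) (by positivity) (by rw [div_le_one hp]; exact r1R) rfl rfl
  have hint := scale_interior hK h0 hmem (t := (h - 1) / h) (div_nonneg hp.le (by linarith))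
    (by rw [div_lt_one] <;> linarith)
  have hne : (h : ℝ) ≠ 0 := by linarith
  have := hon q0 q1 (by
    convert hint using 1
    ext i; fin_cases i
    · simp; field_simp; linear_combination e0R
    · simp; field_simp; linear_combination e1R)
  -- det (v,q) = h - 1
  have hd : v0 * q1 - v1 * q0 = h - 1 := by
    rw [hq0, hq1]; linear_combination (h - 1) * hst
  rw [this.1, this.2] at hd
  lia

lemma det_one (K : Set (Fin 2 → ℝ)) (hK : Convex ℝ K) (h0 : (0 : Fin 2 → ℝ) ∈ interior K)
    (hon : ∀ a b : ℤ, ![(a : ℝ), (b : ℝ)] ∈ interior K → a = 0 ∧ b = 0)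
    (v0 v1 x0 x1 : ℤ) (hv : IsCoprime v0 v1) (hx : ![(x0 : ℝ), (x1 : ℝ)] ∈ K)
    (hy : ![((x0 + 3 * v0 : ℤ) : ℝ), ((x1 + 3 * v1 : ℤ) : ℝ)] ∈ K) :
    (v0 * x1 - v1 * x0).natAbs = 1 := by
  have b1 := no_big_det K hK h0 hon v0 v1 x0 x1 hv hx
    (combo2 hK hx hy (1 / 3) (by norm_num) (by norm_num) (by push_cast; ring) (by push_cast; ring))
  have b2 := no_big_det K hK h0 hon (-v0) (-v1) (x0 + 3 * v0) (x1 + 3 * v1) hv.neg_neg hy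
    (combo2 hK hx hy (2 / 3) (by norm_num) (by norm_num) (by push_cast; ring) (by push_cast; ring))
  have b2' : -(v0 * x1 - v1 * x0) < 2 := by linarith
  have b3 : v0 * x1 - v1 * x0 ≠ 0 := by
    intro hz
    obtain ⟨s, t, hst⟩ := hv
    have hvne : ¬ (v0 = 0 ∧ v1 = 0) := by rintro ⟨rfl, rfl⟩; simp at hst
    obtain ⟨k, hk⟩ : ∃ k, k = s * x0 + t * x1 := ⟨_, rfl⟩
    have k0 : x0 = k * v0 := by rw [hk]; linear_combination (-x0) * hst - t * hz
    have k1 : x1 = k * v1 := by rw [hk]; linear_combination (-x1) * hst + s * hz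
    rcases le_or_gt (-1) k with hk1 | hk1
    · have hkR : (-1 : ℝ) ≤ k := by exact_mod_cast hk1
      have hint := scale_interior hK h0 hy (t := 1 / (k + 3)) (div_nonneg (by norm_num) (by linarith))
        (by rw [div_lt_one] <;> linarith)
      apply hvne
      apply hon
      convert hint using 1
      have : (k : ℝ) + 3 ≠ 0 := by linarith
      rw [k0, k1]
      ext i; fin_cases i <;> simp <;> field_simp
    · have hkR : (k : ℝ) ≤ -2 := by
        have : k ≤ -2 := by lia
        exact_mod_cast this
      have hint := scale_interior hK h0 hx (t := 1 / (-k)) (div_nonneg (by norm_num) (by linarith))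
        (by rw [div_lt_one] <;> linarith)
      apply hvne
      have := hon (-v0) (-v1) ?_
      · simpa using this
      convert hint using 1
      have : (k : ℝ) ≠ 0 := by linarith
      rw [k0, k1]
      ext i; fin_cases i <;> simp <;> field_simp
  lia

lemma pigeon (K : Set (Fin 2 → ℝ)) (hK : Convex ℝ K) (h10 : Set.ncard (K ∩ latticePts2) = 10) :
    ∃ v0 v1 x0 x1 : ℤ, IsCoprime v0 v1 ∧ ![(x0 : ℝ), (x1 : ℝ)] ∈ K ∧
    ![((x0 + 3 * v0 : ℤ) : ℝ), ((x1 + 3 * v1 : ℤ) : ℝ)] ∈ K := by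
  obtain ⟨x, hx, y, hy, hne, hxy⟩ := Set.exists_ne_map_eq_of_ncard_lt_of_maps_to
    (s := K ∩ latticePts2) (t := (univ : Set (ZMod 3 × ZMod 3)))
    (f := fun x => ((⌊x 0⌋ : ZMod 3), (⌊x 1⌋ : ZMod 3)))
    (by rw [h10, Set.ncard_univ]; simp) (fun _ _ => mem_univ _) (Set.toFinite _)
  obtain ⟨x0, hx0⟩ := hx.2 0
  obtain ⟨x1, hx1⟩ := hx.2 1
  obtain ⟨y0, hy0⟩ := hy.2 0
  obtain ⟨y1, hy1⟩ := hy.2 1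
  have hxK := hx.1
  have hyK := hy.1
  simp only [hx0, hx1, hy0, hy1, Int.floor_intCast, Prod.mk.injEq, ZMod.intCast_eq_intCast_iff_dvd_sub] at hxy
  rw [← eta2 x, hx0, hx1] at hxK
  rw [← eta2 y, hy0, hy1] at hyK
  obtain ⟨⟨u0, hu0⟩, ⟨u1, hu1⟩⟩ := hxy
  push_cast at hu0 hu1
  have hu : u0 ≠ 0 ∨ u1 ≠ 0 := by
    by_contra! hcon
    apply hne
    rw [← eta2 x, ← eta2 y, hx0, hx1, hy0, hy1]
    have : y0 = x0 := by rw [hcon.1] at hu0; linarith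
    have : y1 = x1 := by rw [hcon.2] at hu1; linarith
    simp [*]
  have hg : 0 < Int.gcd u0 u1 := Int.gcd_pos_iff.2 hu
  obtain ⟨v0, v1, hcop, h1, h2⟩ := Int.exists_gcd_one hg
  set g := Int.gcd u0 u1
  refine ⟨v0, v1, x0, x1, Int.isCoprime_iff_gcd_eq_one.2 hcop, hxK, ?_⟩
  have hgR : (1 : ℝ) ≤ g := by exact_mod_cast hg
  have ey0 : (y0 : ℝ) = x0 + 3 * (v0 * g) := by
    have : y0 = x0 + 3 * (v0 * g) := by rw [← h1]; linarith
    exact_mod_cast this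
  have ey1 : (y1 : ℝ) = x1 + 3 * (v1 * g) := by
    have : y1 = x1 + 3 * (v1 * g) := by rw [← h2]; linarith
    exact_mod_cast this
  refine combo2 hK hxK hyK (1 / g) (by positivity) (by rw [div_le_one] <;> linarith) ?_ ?_
  · rw [ey0]; push_cast; field_simp; ring
  · rw [ey1]; push_cast; field_simp; ring

lemma tri_ncard : Set.ncard (ehrhartTriangle ∩ latticePts2) = 10 := by
  set F : Finset (ℤ × ℤ) := (Finset.Icc (-1) 2 ×ˢ Finset.Icc (-1) 2).filter (fun p => p.1 + p.2 ≤ 1)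
    with hF
  have : ehrhartTriangle ∩ latticePts2 = (fun p : ℤ × ℤ => ![(p.1 : ℝ), (p.2 : ℝ)]) '' (F : Set (ℤ × ℤ)) := by
    ext x
    constructor
    · rintro ⟨hx, hl⟩
      obtain ⟨a, ha⟩ := hl 0
      obtain ⟨b, hb⟩ := hl 1
      rw [← eta2 x, ha, hb, tri_mem] at hx
      obtain ⟨h1, h2, h3⟩ := hx
      have h1' : -1 ≤ a := by exact_mod_cast h1
      have h2' : -1 ≤ b := by exact_mod_cast h2
      have h3' : a + b ≤ 1 := by exact_mod_cast h3
      refine ⟨(a, b), ?_, by rw [← eta2 x, ha, hb]⟩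
      simp [hF]
      lia
    · rintro ⟨⟨a, b⟩, hab, rfl⟩
      simp [hF] at hab
      refine ⟨?_, ?_⟩
      · simp only [tri_mem]
        refine ⟨?_, ?_, ?_⟩ <;> norm_cast <;> lia
      · intro i; fin_cases i
        · exact ⟨a, by simp⟩
        · exact ⟨b, by simp⟩
  rw [this, Set.ncard_image_of_injective, Set.ncard_coe_finset]
  · decide
  · rintro ⟨a, b⟩ ⟨c, d⟩ h
    have h0 := congrFun h 0
    have h1 := congrFun h 1
    simp at h0 h1
    simp [h0, h1]

/-- **Equality case in the planar bound.** Let `K ⊆ ℝ²` be a convex body with centroid at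
the origin whose only interior lattice point is the origin. Then `#(K ∩ ℤ²) = 10` if and
only if `K` is unimodularly equivalent to the triangle `S₂ = conv{(-1,-1),(2,-1),(-1,2)}`,
i.e. `K = U S₂ + z` for some integer matrix `U` with `|det U| = 1` and some `z ∈ ℤ²`. -/
theorem planar_lattice_point_bound_equality (K : Set (Fin 2 → ℝ))
    (hKcpt : IsCompact K) (hKconv : Convex ℝ K) (hKint : (interior K).Nonempty)
    (hcent : (⨍ x in K, x) = (0 : Fin 2 → ℝ))
    (honly : interior K ∩ latticePts2 = {0}) :
    Set.ncard (K ∩ latticePts2) = 10 ↔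
      ∃ U : Matrix (Fin 2) (Fin 2) ℤ, U.det.natAbs = 1 ∧ ∃ z : Fin 2 → ℤ,
        K = (fun x => (U.map ((↑) : ℤ → ℝ)).mulVec x + fun i => (z i : ℝ)) ''
          ehrhartTriangle := by
  constructor
  · intro h10
    have h0 : (0 : Fin 2 → ℝ) ∈ interior K := by
      have : (0 : Fin 2 → ℝ) ∈ interior K ∩ latticePts2 := by rw [honly]; rfl
      exact this.1
    have hon : ∀ a b : ℤ, ![(a : ℝ), (b : ℝ)] ∈ interior K → a = 0 ∧ b = 0 := by
      intro a b hab
      have : ![(a : ℝ), (b : ℝ)] ∈ interior K ∩ latticePts2 := by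
        refine ⟨hab, ?_⟩
        intro i; fin_cases i
        · exact ⟨a, by simp⟩
        · exact ⟨b, by simp⟩
      rw [honly] at this
      have e0 := congrFun this 0
      have e1 := congrFun this 1
      simpa using And.intro e0 e1
    obtain ⟨v0, v1, x0, x1, hv, hx, hy⟩ := pigeon K hKconv h10
    have hdet := det_one K hKconv h0 hon v0 v1 x0 x1 hv hx hy
    -- integral of linear functionals
    have hintK : IntegrableOn (fun x : Fin 2 → ℝ => x) K := continuousOn_id.integrableOn_compact hKcpt
    have hzero : ∫ x in K, x = (0 : Fin 2 → ℝ) := by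
      rw [setAverage_eq, smul_eq_zero] at hcent
      rcases hcent with h | h
      · exfalso
        have hpos : 0 < volume K := (isOpen_interior.measure_pos volume hKint).trans_le (measure_mono interior_subset)
        have : 0 < volume.real K := ENNReal.toReal_pos hpos.ne' hKcpt.measure_lt_top.ne
        exact this.ne' (inv_eq_zero.1 h)
      · exact h
    set U : Matrix (Fin 2) (Fin 2) ℤ := !![v0, -(x0 + v0); v1, -(x1 + v1)] with hU
    have hUdet : U.det = -(v0 * x1 - v1 * x0) := by
      rw [hU, Matrix.det_fin_two_of]; ring
    have hUabs : U.det.natAbs = 1 := by rw [hUdet, Int.natAbs_neg, hdet]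
    set M : Matrix (Fin 2) (Fin 2) ℝ := U.map ((↑) : ℤ → ℝ) with hM
    have hMdet : M.det = (U.det : ℝ) := (Int.cast_det U).symm
    have hMabs : |M.det| = 1 := by
      rw [hMdet, ← Int.cast_abs, Int.abs_eq_natAbs, hUabs]; simp
    have hMne : M.det ≠ 0 := by intro h; rw [h] at hMabs; simp at hMabs
    have hMu : IsUnit M.det := isUnit_iff_ne_zero.2 hMne
    set L : (Fin 2 → ℝ) ≃L[ℝ] (Fin 2 → ℝ) :=
      (Matrix.toLin'OfInv (Matrix.nonsing_inv_mul M hMu) (Matrix.mul_nonsing_inv M hMu)).toContinuousLinearEquiv with hL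
    have hLap : ∀ x, L x = M.mulVec x := fun x => rfl
    have hLcoord : ∀ a b : ℝ, L ![a, b] = ![v0 * a - (x0 + v0) * b, v1 * a - (x1 + v1) * b] := by
      intro a b
      rw [hLap, hM, hU]
      ext i; fin_cases i <;> simp [Matrix.mulVec, dotProduct, Fin.sum_univ_two] <;> ring
    have hmp : MeasurePreserving L volume volume := by
      refine ⟨L.continuous.measurable, ?_⟩
      have := Real.map_matrix_volume_pi_eq_smul_volume_pi hMne
      rw [abs_inv, hMabs] at this
      have hfun : (L : (Fin 2 → ℝ) → (Fin 2 → ℝ)) = Matrix.toLin' M := by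
        funext x; rw [hLap, Matrix.toLin'_apply]
      rw [hfun, this]; simp
    have hme : MeasurableEmbedding L := L.toHomeomorph.measurableEmbedding
    have hint' : L ⁻¹' interior K = interior (L ⁻¹' K) := L.toHomeomorph.preimage_interior K
    have hon' : ∀ a b : ℤ, ![(a : ℝ), (b : ℝ)] ∈ interior (L ⁻¹' K) → a = 0 ∧ b = 0 := by
      intro a b hab
      rw [← hint', mem_preimage, hLcoord] at hab
      have := hon (v0 * a - (x0 + v0) * b) (v1 * a - (x1 + v1) * b) (by push_cast; exact hab)
      have hz : L ![(a : ℝ), (b : ℝ)] = 0 := by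
        rw [hLcoord]
        have e1 : (v0 * a - (x0 + v0) * b : ℝ) = 0 := by exact_mod_cast this.1
        have e2 : (v1 * a - (x1 + v1) * b : ℝ) = 0 := by exact_mod_cast this.2
        rw [e1, e2]; ext i; fin_cases i <;> rfl
      have hz' : ![(a : ℝ), (b : ℝ)] = 0 := by simpa using hz
      have e0 := congrFun hz' 0
      have e1 := congrFun hz' 1
      simpa using And.intro e0 e1
    have hcore := core_s5 (L ⁻¹' K) (L.toHomeomorph.isCompact_preimage.2 hKcpt)
      (hKconv.linear_preimage (L : (Fin 2 → ℝ) →ₗ[ℝ] (Fin 2 → ℝ)))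
      (by rw [← hint', mem_preimage, map_zero]; exact h0)
      (fun h => by have := hon' 1 0 (by simpa using h); simp at this)
      (fun h => by have := hon' (-1) 0 (by simpa using h); simp at this)
      (fun h => by have := hon' 0 (-1) (by simpa using h); simp at this)
      (by rw [mem_preimage, hLcoord]; convert hx using 2 <;> ring_nf)
      (by rw [mem_preimage, hLcoord]; convert hy using 2 <;> push_cast <;> ring_nf)
      (by
        have e := hmp.setIntegral_preimage_emb hme (fun y => (L.symm y) 1) K
        simp only [ContinuousLinearEquiv.symm_apply_apply] at e
        rw [e]
        have := ContinuousLinearMap.integral_comp_comm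
          ((ContinuousLinearMap.proj (R := ℝ) (φ := fun _ : Fin 2 => ℝ) 1).comp (L.symm : (Fin 2 → ℝ) →L[ℝ] (Fin 2 → ℝ))) hintK
        rw [hzero, map_zero] at this
        exact this)
    refine ⟨U, hUabs, 0, ?_⟩
    have hsurj := image_preimage_eq K L.surjective
    rw [hcore] at hsurj
    rw [← hsurj]
    apply image_congr
    intro x _
    rw [hLap]
    ext i; simp [hM]
  · rintro ⟨U, hU, z, rfl⟩
    have hD : ((U 0 0 : ℝ) * U 1 1 - U 0 1 * U 1 0) * ((U 0 0 : ℝ) * U 1 1 - U 0 1 * U 1 0) = 1 := by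
      have : U.det * U.det = 1 := by
        rcases Int.natAbs_eq_iff.1 hU with h | h <;> rw [h] <;> norm_num
      rw [Matrix.det_fin_two] at this
      exact_mod_cast this
    set φ : (Fin 2 → ℝ) → (Fin 2 → ℝ) :=
      fun x => (U.map ((↑) : ℤ → ℝ)).mulVec x + fun i => (z i : ℝ) with hφ
    have c0 : ∀ x, φ x 0 = U 0 0 * x 0 + U 0 1 * x 1 + z 0 := by
      intro x; simp only [hφ, Pi.add_apply, Matrix.mulVec, dotProduct, Fin.sum_univ_two, Matrix.map_apply]
    have c1 : ∀ x, φ x 1 = U 1 0 * x 0 + U 1 1 * x 1 + z 1 := by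
      intro x; simp only [hφ, Pi.add_apply, Matrix.mulVec, dotProduct, Fin.sum_univ_two, Matrix.map_apply]
    have i0 : ∀ x, x 0 = ((U 0 0 : ℝ) * U 1 1 - U 0 1 * U 1 0) * (U 1 1 * (φ x 0 - z 0) - U 0 1 * (φ x 1 - z 1)) := by
      intro x; rw [c0, c1]; linear_combination (-x 0) * hD
    have i1 : ∀ x, x 1 = ((U 0 0 : ℝ) * U 1 1 - U 0 1 * U 1 0) * (U 0 0 * (φ x 1 - z 1) - U 1 0 * (φ x 0 - z 0)) := by
      intro x; rw [c0, c1]; linear_combination (-x 1) * hD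
    have hinj : Function.Injective φ := by
      intro x y hxy
      rw [← eta2 x, ← eta2 y, i0 x, i1 x, i0 y, i1 y, hxy]
    have : φ '' ehrhartTriangle ∩ latticePts2 = φ '' (ehrhartTriangle ∩ latticePts2) := by
      ext y
      constructor
      · rintro ⟨⟨x, hx, rfl⟩, hl⟩
        refine ⟨x, ⟨hx, ?_⟩, rfl⟩
        obtain ⟨a, ha⟩ := hl 0
        obtain ⟨b, hb⟩ := hl 1
        intro i; fin_cases i
        · exact ⟨(U 0 0 * U 1 1 - U 0 1 * U 1 0) * (U 1 1 * (a - z 0) - U 0 1 * (b - z 1)), by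
            have := i0 x; rw [ha, hb] at this; push_cast; exact this⟩
        · exact ⟨(U 0 0 * U 1 1 - U 0 1 * U 1 0) * (U 0 0 * (b - z 1) - U 1 0 * (a - z 0)), by
            have := i1 x; rw [ha, hb] at this; push_cast; exact this⟩
      · rintro ⟨x, ⟨hx, hl⟩, rfl⟩
        refine ⟨⟨x, hx, rfl⟩, ?_⟩
        obtain ⟨a, ha⟩ := hl 0
        obtain ⟨b, hb⟩ := hl 1
        intro i; fin_cases i
        · exact ⟨U 0 0 * a + U 0 1 * b + z 0, by
            have := c0 x; rw [ha, hb] at this; push_cast; exact this⟩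
        · exact ⟨U 1 0 * a + U 1 1 * b + z 1, by
            have := c1 x; rw [ha, hb] at this; push_cast; exact this⟩
    rw [this, Set.ncard_image_of_injective _ hinj, tri_ncard]
end
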